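/- (Almeida–Lima.) An Artin group A(Γ) is subgroup separable if and only if the Artin graph Γ does not contain, as an induced labeled subgraph, any of the following: a path P_4 on 4 vertices with all edges labeled 2; a cycle C_4 on 4 vertices with all edges labeled 2; a chordal Artin square S_p with p > 2; a chordal Artin square S_{p,q} with p, q > 2; a 3-vertex path P_3^{m,n} with m + n > 4; or a triangle Δ_{l,m,n} having at most one edge labeled 2. -/

import Mathlib

/-- The alternating product `u v u v …` of length `m`. -/
def altProd {G : Type*} [Monoid G] (u v : G) (m : ℕ) : G :=
  ((List.range m).map (fun i => if i % 2 = 0 then u else v)).prod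

/-- Relations of the Artin group of an Artin graph `(G, ℓ)`:
`(u,v)_{ℓ u v} = (v,u)_{ℓ u v}` for each edge `{u,v}`. -/
def artinRels {V : Type*} (G : SimpleGraph V) (ℓ : V → V → ℕ) : Set (FreeGroup V) :=
  {r | ∃ u v : V, G.Adj u v ∧
    r = altProd (FreeGroup.of u) (FreeGroup.of v) (ℓ u v) *
        (altProd (FreeGroup.of v) (FreeGroup.of u) (ℓ u v))⁻¹}

/-- The Artin group of an Artin graph `(G, ℓ)`. -/
abbrev ArtinGroup {V : Type*} (G : SimpleGraph V) (ℓ : V → V → ℕ) :=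
  PresentedGroup (artinRels G ℓ)

/-- A group `G` is subgroup separable if every finitely generated subgroup of `G` is an
intersection of finite-index subgroups of `G`. -/
def SubgroupSeparable (G : Type*) [Group G] : Prop :=
  ∀ H : Subgroup G, H.FG →
    ∃ S : Set (Subgroup G), (∀ K ∈ S, K.FiniteIndex) ∧ H = sInf S

/-- The Artin graph `(Γ, ℓ)` contains the Artin graph `(H, ℓ′)` as an induced labeled
subgraph: there is an injection of vertices preserving and reflecting adjacency and
preserving the edge labels. -/
def HasInducedLabeled {V W : Type*} (Γ : SimpleGraph V) (ℓ : V → V → ℕ)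
    (H : SimpleGraph W) (ℓ' : W → W → ℕ) : Prop :=
  ∃ φ : W → V, Function.Injective φ ∧
    (∀ i j, Γ.Adj (φ i) (φ j) ↔ H.Adj i j) ∧
    (∀ i j, H.Adj i j → ℓ (φ i) (φ j) = ℓ' i j)

/-- The graph underlying the chordal Artin squares `S_p` and `S_{p,q}` (without the diagonal
`{a,c}` for `S_p`): vertices `a = 0, b = 1, c = 2, d = 3`. The graph of `S_p` is the complete
graph on four vertices minus the diagonal `{a, c} = {0, 2}`. -/
def SpGraph : SimpleGraph (Fin 4) :=
  (⊤ : SimpleGraph (Fin 4)).deleteEdges {s((0 : Fin 4), (2 : Fin 4))}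

/-- Labels for `S_p`: the diagonal `{b, d} = {1, 3}` is labeled `p`, all square edges are
labeled `2`. -/
def SpLabel (p : ℕ) : Fin 4 → Fin 4 → ℕ := fun i j =>
  if (i = 1 ∧ j = 3) ∨ (i = 3 ∧ j = 1) then p else 2

/-- Labels for `S_{p,q}` (on the complete graph on four vertices): the diagonal `{b, d} = {1, 3}`
is labeled `p`, the diagonal `{a, c} = {0, 2}` is labeled `q`, and the square edges are
labeled `2`. -/
def SpqLabel (p q : ℕ) : Fin 4 → Fin 4 → ℕ := fun i j =>
  if (i = 1 ∧ j = 3) ∨ (i = 3 ∧ j = 1) then p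
  else if (i = 0 ∧ j = 2) ∨ (i = 2 ∧ j = 0) then q
  else 2

/-- Labels for the path `P₃^{m,n}` on vertices `a = 0, b = 1, c = 2`: the edge `{a, b}` is
labeled `m` and the edge `{b, c}` is labeled `n`. -/
def P3Label (m n : ℕ) : Fin 3 → Fin 3 → ℕ := fun i j =>
  if (i = 0 ∧ j = 1) ∨ (i = 1 ∧ j = 0) then m else n

/-- Labels for the triangle `Δ_{l,m,n}` on vertices `a = 0, b = 1, c = 2`: the edge `{a, b}`
is labeled `l`, the edge `{b, c}` is labeled `m`, and the edge `{a, c}` is labeled `n`. -/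
def triLabel (l m n : ℕ) : Fin 3 → Fin 3 → ℕ := fun i j =>
  if (i = 0 ∧ j = 1) ∨ (i = 1 ∧ j = 0) then l
  else if (i = 1 ∧ j = 2) ∨ (i = 2 ∧ j = 1) then m
  else n

/-- The Artin graph `(Γ, ℓ)` contains one of the forbidden induced labeled subgraphs other
than the triangles: `P₄` or `C₄` with all edges labeled `2`, a chordal Artin square `S_p` with
`p > 2`, a chordal Artin square `S_{p,q}` with `p, q > 2`, or a path `P₃^{m,n}` with
`m + n > 4`. -/
def HasForbiddenNonTriangle {V : Type*} (Γ : SimpleGraph V) (ℓ : V → V → ℕ) : Prop :=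
  HasInducedLabeled Γ ℓ (SimpleGraph.pathGraph 4) (fun _ _ => 2) ∨
  HasInducedLabeled Γ ℓ (SimpleGraph.cycleGraph 4) (fun _ _ => 2) ∨
  (∃ p, 2 < p ∧ HasInducedLabeled Γ ℓ SpGraph (SpLabel p)) ∨
  (∃ p q, 2 < p ∧ 2 < q ∧
    HasInducedLabeled Γ ℓ (⊤ : SimpleGraph (Fin 4)) (SpqLabel p q)) ∨
  (∃ m n, 2 ≤ m ∧ 2 ≤ n ∧ 4 < m + n ∧
    HasInducedLabeled Γ ℓ (SimpleGraph.pathGraph 3) (P3Label m n))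

/-- The Artin graph `(Γ, ℓ)` contains a forbidden triangle: an induced triangle `Δ_{l,m,n}`
with at most one edge labeled `2`. -/
def HasForbiddenTriangle {V : Type*} (Γ : SimpleGraph V) (ℓ : V → V → ℕ) : Prop :=
  ∃ l m n, 2 ≤ l ∧ 2 ≤ m ∧ 2 ≤ n ∧
    ((if l = 2 then 1 else 0) + (if m = 2 then 1 else 0) + (if n = 2 then 1 else 0) ≤ 1) ∧
    HasInducedLabeled Γ ℓ (⊤ : SimpleGraph (Fin 3)) (triLabel l m n)



/-! ### Part 1: subgroup separability toolbox -/

theorem fg_map' {G L : Type*} [Group G] [Group L] {H : Subgroup G} (hH : H.FG) (f : G →* L) :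
    (H.map f).FG := by
  classical
  obtain ⟨S, rfl⟩ := hH
  exact ⟨S.image f, by rw [MonoidHom.map_closure, Finset.coe_image]⟩

theorem fg_of_fg_map {G L : Type*} [Group G] [Group L] {H : Subgroup G} (f : G →* L)
    (hf : Function.Injective f) (h : (H.map f).FG) : H.FG := by
  classical
  obtain ⟨S, hS⟩ := h
  have hS2 : (S : Set L) ⊆ f '' (H : Set G) := by
    intro x hx
    have : x ∈ H.map f := hS ▸ Subgroup.subset_closure hx
    exact this
  refine ⟨S.preimage f hf.injOn, ?_⟩
  apply Subgroup.map_injective hf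
  rw [MonoidHom.map_closure, ← hS]
  congr 1
  rw [Finset.coe_preimage, Set.image_preimage_eq_of_subset]
  exact hS2.trans (Set.image_subset_range _ _)

theorem finiteIndex_comap' {G L : Type*} [Group G] [Group L] (f : G →* L) {K : Subgroup L}
    (hK : K.FiniteIndex) : (K.comap f).FiniteIndex := by
  constructor
  rw [Subgroup.index_comap]
  have := hK
  exact Subgroup.FiniteIndex.index_ne_zero

theorem lerf_iff {G : Type*} [Group G] : SubgroupSeparable G ↔
    ∀ H : Subgroup G, H.FG → ∀ g, g ∉ H → ∃ K : Subgroup G, K.FiniteIndex ∧ H ≤ K ∧ g ∉ K := by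
  constructor
  · intro h H hH g hg
    obtain ⟨S, hS, rfl⟩ := h H hH
    rw [Subgroup.mem_sInf] at hg
    push Not at hg
    obtain ⟨K, hK, hgK⟩ := hg
    exact ⟨K, hS K hK, sInf_le hK, hgK⟩
  · intro h H hH
    refine ⟨{K | K.FiniteIndex ∧ H ≤ K}, fun K hK => hK.1, ?_⟩
    apply le_antisymm
    · exact le_sInf fun K hK => hK.2
    · intro g hg
      by_contra hgH
      obtain ⟨K, h1, h2, h3⟩ := h H hH g hgH
      exact h3 (Subgroup.mem_sInf.1 hg K ⟨h1, h2⟩)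

theorem lerf_of_injective {G L : Type*} [Group G] [Group L] (f : G →* L)
    (hf : Function.Injective f) (hL : SubgroupSeparable L) : SubgroupSeparable G := by
  rw [lerf_iff] at hL ⊢
  intro H hH g hg
  obtain ⟨K, h1, h2, h3⟩ := hL (H.map f) (fg_map' hH f) (f g) (by
    rintro ⟨x, hx, hxg⟩
    exact hg (hf hxg ▸ hx))
  exact ⟨K.comap f, finiteIndex_comap' f h1, Subgroup.map_le_iff_le_comap.1 h2, h3⟩

theorem lerf_of_finite (G : Type*) [Group G] [Finite G] : SubgroupSeparable G := by
  rw [lerf_iff]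
  intro H _ g hg
  exact ⟨H, inferInstance, le_rfl, hg⟩

/-- subgroup separability passes to finite-index overgroups -/
theorem lerf_of_finiteIndex {G : Type*} [Group G] (G₀ : Subgroup G) [G₀.FiniteIndex]
    (h₀ : SubgroupSeparable G₀) : SubgroupSeparable G := by
  rw [lerf_iff] at h₀ ⊢
  intro H hH x hx
  -- for each t in H find a normal finite-index N with t⁻¹ x ∉ (H ⊓ G₀) N
  have hfg : (G₀.subgroupOf H).FG := by
    have : Group.FG H := (Group.fg_iff_subgroup_fg H).2 hH
    exact (Group.fg_iff_subgroup_fg _).1 (Subgroup.fg_of_index_ne_zero _)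
  have hLfg : (H.subgroupOf G₀).FG := by
    have h1 : ((G₀.subgroupOf H).map H.subtype).FG := fg_map' hfg _
    have h2 : (G₀.subgroupOf H).map H.subtype = (H.subgroupOf G₀).map G₀.subtype := by
      rw [Subgroup.subgroupOf_map_subtype, Subgroup.subgroupOf_map_subtype, inf_comm]
    rw [h2] at h1
    exact fg_of_fg_map _ G₀.subtype_injective h1
  have key : ∀ y : G, y ∉ H → ∃ N : Subgroup G, N.Normal ∧ N.FiniteIndex ∧
      ∀ l ∈ H, l ∈ G₀ → l⁻¹ * y ∉ N := by
    intro y hy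
    by_cases hyG : y ∈ G₀
    · obtain ⟨K, hK, hLK, hyK⟩ := h₀ (H.subgroupOf G₀) hLfg ⟨y, hyG⟩ (by
        simpa [Subgroup.mem_subgroupOf] using hy)
      have : (K.map G₀.subtype).FiniteIndex := by
        constructor
        rw [Subgroup.index_map_subtype]
        exact mul_ne_zero hK.index_ne_zero Subgroup.FiniteIndex.index_ne_zero
      refine ⟨(K.map G₀.subtype).normalCore, inferInstance, inferInstance, ?_⟩
      intro l hl hlG hmem
      obtain ⟨k, hk, hk2⟩ := Subgroup.normalCore_le _ hmem
      have : (⟨y, hyG⟩ : G₀) = ⟨l, hlG⟩ * k := by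
        ext; simp at hk2; simp [hk2]
      apply hyK
      rw [this]
      exact K.mul_mem (hLK (by simpa [Subgroup.mem_subgroupOf] using hl)) hk
    · refine ⟨G₀.normalCore, inferInstance, inferInstance, ?_⟩
      intro l hl hlG hmem
      have := G₀.mul_mem hlG (Subgroup.normalCore_le _ hmem)
      simp at this
      exact hyG this
  have hT : ∀ t : H, ∃ N : Subgroup G, N.Normal ∧ N.FiniteIndex ∧
      ∀ l ∈ H, l ∈ G₀ → l⁻¹ * ((t : G)⁻¹ * x) ∉ N := fun t => key _ (by
    intro h
    exact hx (by simpa using H.mul_mem t.2 h))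
  choose N hN1 hN2 hN3 using hT
  -- finitely many cosets of G₀ ⊓ H in H
  have : Finite (H ⧸ (G₀.subgroupOf H)) := inferInstance
  let M : Subgroup G := ⨅ c : H ⧸ (G₀.subgroupOf H), N c.out
  have hMn : M.Normal := Subgroup.normal_iInf_normal fun c => hN1 _
  have hMf : M.FiniteIndex := Subgroup.finiteIndex_iInf fun c => hN2 _
  refine ⟨H ⊔ M, Subgroup.finiteIndex_of_le le_sup_right, le_sup_left, ?_⟩
  intro hmem
  rw [Subgroup.mem_sup_of_normal_right] at hmem
  obtain ⟨h, hh, m, hm, rfl⟩ := hmem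
  let c : H ⧸ (G₀.subgroupOf H) := QuotientGroup.mk ⟨h, hh⟩
  have hc : (c.out)⁻¹ * ⟨h, hh⟩ ∈ G₀.subgroupOf H := by
    rw [← QuotientGroup.eq]; simp [c]
  have := hN3 c.out ((c.out : G)⁻¹ * h) (H.mul_mem (H.inv_mem c.out.2) hh)
    (by simpa [Subgroup.mem_subgroupOf] using hc)
  apply this
  have hm' : m ∈ N c.out := (Subgroup.mem_iInf.1 hm c)
  have e : ((c.out : G)⁻¹ * h)⁻¹ * ((c.out : G)⁻¹ * (h * m)) = m := by group
  rw [e]; exact hm'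

theorem lerf_prod_finite (G Z : Type*) [Group G] [Group Z] [Finite Z]
    (h : SubgroupSeparable G) : SubgroupSeparable (G × Z) := by
  have : (MonoidHom.snd G Z).ker.FiniteIndex := by
    exact Subgroup.finiteIndex_ker _
  apply lerf_of_finiteIndex (MonoidHom.snd G Z).ker
  refine lerf_of_injective ((MonoidHom.fst G Z).comp (Subgroup.subtype _)) ?_ h
  rintro ⟨⟨a, b⟩, hab⟩ ⟨⟨c, d⟩, hcd⟩ he
  rw [MonoidHom.mem_ker] at hab hcd
  have hb : b = 1 := hab
  have hd : d = 1 := hcd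
  have hac : a = c := he
  subst hb hd hac
  rfl

theorem lerf_prod_int (G : Type*) [Group G]
    (h : SubgroupSeparable G) : SubgroupSeparable (G × Multiplicative ℤ) := by
  rw [lerf_iff]
  rintro H hH ⟨g, n⟩ hg
  by_cases hg1 : g ∈ H.map (MonoidHom.fst G (Multiplicative ℤ))
  · obtain ⟨⟨g', m⟩, hm, hgg⟩ := hg1
    simp only [MonoidHom.coe_fst] at hgg
    subst hgg
    -- r = n - m
    have hr : ((1 : G), m⁻¹ * n) ∉ H := by
      intro h1
      have := H.mul_mem hm h1
      simp at this
      exact hg this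
    let c : AddSubgroup ℤ := Subgroup.toAddSubgroup' (H.comap (MonoidHom.inr G (Multiplicative ℤ)))
    have hcmem : ∀ j : ℤ, j ∈ c ↔ ((1 : G), Multiplicative.ofAdd j) ∈ H := fun j => Iff.rfl
    obtain ⟨N, hN0, hNc, hNr⟩ : ∃ N : ℕ, N ≠ 0 ∧ (∀ j ∈ c, (N : ℤ) ∣ j) ∧
        ¬ ((N : ℤ) ∣ (m⁻¹ * n).toAdd) := by
      obtain ⟨k, hk⟩ := Int.subgroup_cyclic c
      have hrc : (m⁻¹ * n).toAdd ∉ c := hr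
      by_cases hk0 : k = 0
      · refine ⟨((m⁻¹ * n).toAdd).natAbs + 1, by omega, ?_, ?_⟩
        · intro j hj
          rw [hk, hk0, AddSubgroup.mem_closure_singleton] at hj
          obtain ⟨z, rfl⟩ := hj
          simp
        · intro hd
          have h0 : (m⁻¹ * n).toAdd ≠ 0 := by
            intro h0; rw [h0] at hrc; exact hrc c.zero_mem
          have := Int.le_of_dvd (by simpa using h0) ((dvd_abs _ _).2 hd)
          push_cast at this
          omega
      · refine ⟨k.natAbs, by simpa using hk0, ?_, ?_⟩
        · intro j hj
          rw [hk, AddSubgroup.mem_closure_singleton] at hj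
          obtain ⟨z, rfl⟩ := hj
          simp
        · intro hd
          apply hrc
          rw [hk, AddSubgroup.mem_closure_singleton]
          obtain ⟨z, hz⟩ := Int.natAbs_dvd.1 hd
          exact ⟨z, by rw [hz]; simp [mul_comm]⟩
    have : NeZero N := ⟨hN0⟩
    let f : G × Multiplicative ℤ →* G × Multiplicative (ZMod N) :=
      MonoidHom.prodMap (MonoidHom.id G)
        (AddMonoidHom.toMultiplicative (Int.castAddHom (ZMod N)))
    have hfin := lerf_prod_finite G (Multiplicative (ZMod N)) h
    rw [lerf_iff] at hfin
    obtain ⟨K, hK1, hK2, hK3⟩ := hfin (H.map f) (fg_map' hH f) (f (g', n)) (by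
      rintro ⟨⟨g2, n2⟩, h2, he⟩
      simp only [f, MonoidHom.prodMap, MonoidHom.prod_apply, MonoidHom.coe_comp, Function.comp,
        Prod.mk.injEq, MonoidHom.coe_fst, MonoidHom.coe_snd, MonoidHom.id_apply] at he
      obtain ⟨rfl, he2⟩ := he
      have h3 := H.mul_mem (H.inv_mem hm) h2
      simp at h3
      have h4 := hNc _ ((hcmem (m⁻¹ * n2).toAdd).2 h3)
      apply hNr
      have h5 : ((n2.toAdd : ℤ) : ZMod N) = ((n.toAdd : ℤ) : ZMod N) := he2
      rw [ZMod.intCast_eq_intCast_iff_dvd_sub] at h5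
      have : (m⁻¹ * n).toAdd = (m⁻¹ * n2).toAdd + (n.toAdd - n2.toAdd) := by
        simp
      rw [this]
      exact dvd_add h4 h5)
    exact ⟨K.comap f, finiteIndex_comap' f hK1, Subgroup.map_le_iff_le_comap.1 hK2, hK3⟩
  · rw [lerf_iff] at h
    obtain ⟨K, h1, h2, h3⟩ := h _ (fg_map' hH _) g hg1
    exact ⟨K.comap (MonoidHom.fst G (Multiplicative ℤ)), finiteIndex_comap' _ h1,
      Subgroup.map_le_iff_le_comap.1 h2, h3⟩


universe u
/-! ### Free products -/

/-- partial equivariance of a map `ι` on a finite set -/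
def PEquiv' {G X Y : Type*} [Group G] (ρ : G →* Equiv.Perm X) (θ : G →* Equiv.Perm Y)
    (F : Finset X) (S : Finset G) (ι : X → Y) : Prop :=
  ∀ s ∈ S, ∀ x ∈ F, ρ s x ∈ F → ι (ρ s x) = θ s (ι x)

theorem PEquiv'.mono {G X Y : Type*} [Group G] {ρ : G →* Equiv.Perm X} {θ : G →* Equiv.Perm Y}
    {F F' : Finset X} {S S' : Finset G} {ι : X → Y} (h : PEquiv' ρ θ F' S' ι)
    (hF : F ⊆ F') (hS : S ⊆ S') : PEquiv' ρ θ F S ι :=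
  fun s hs x hx hx' => h s (hS hs) x (hF hx) (hF hx')

theorem lerf_pair {G X : Type u} [Group G] (hG : SubgroupSeparable G)
    (ρ : G →* Equiv.Perm X) (F : Finset X) (S : Finset G) (p q : X) (hpq : p ≠ q) :
    ∃ (Y : Type u) (_ : Finite Y) (θ : G →* Equiv.Perm Y) (ι : X → Y),
      ι p ≠ ι q ∧ PEquiv' ρ θ F S ι := by
  classical
  by_cases ho : ∃ g, ρ g p = q
  · -- same orbit
    have ha : ∀ x : X, ∃ a : G, (∃ g, ρ g p = x) → ρ a p = x := by
      intro x
      by_cases hx : ∃ g, ρ g p = x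
      · obtain ⟨g, hg⟩ := hx
        exact ⟨g, fun _ => hg⟩
      · exact ⟨1, fun h => absurd h hx⟩
    choose a ha using ha
    let T : Finset G := ((S ×ˢ F).filter (fun sx => ∃ g, ρ g p = sx.2)).image
      (fun sx => (a (ρ sx.1 sx.2))⁻¹ * sx.1 * a sx.2)
    have hp : ρ (a p) p = p := ha p ⟨1, by simp⟩
    have hstep : ∀ s x, (∃ g, ρ g p = x) → ∃ g, ρ g p = ρ s x := by
      rintro s x ⟨g, hg⟩
      exact ⟨s * g, by simp [hg]⟩
    have hT : ∀ t ∈ Subgroup.closure (T : Set G), ρ t p = p := by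
      intro t ht
      induction ht using Subgroup.closure_induction with
      | mem t ht =>
        simp only [T, Finset.coe_image, Set.mem_image, Finset.mem_coe, Finset.mem_filter] at ht
        obtain ⟨⟨s, x⟩, ⟨_, hx⟩, rfl⟩ := ht
        simp only at hx
        have h1 := ha x hx
        have h2 := ha (ρ s x) (hstep s x hx)
        simp only [map_mul, Equiv.Perm.mul_apply, h1, map_inv]
        rw [Equiv.Perm.inv_eq_iff_eq, h2]
      | one => simp
      | mul a b _ _ h1 h2 => simp [h1, h2]
      | inv a _ h1 => rw [map_inv, Equiv.Perm.inv_eq_iff_eq, h1]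
    have hnot : (a p)⁻¹ * a q ∉ Subgroup.closure (T : Set G) := by
      intro h
      have := hT _ h
      simp only [map_mul, Equiv.Perm.mul_apply, map_inv, ha q ho] at this
      rw [Equiv.Perm.inv_eq_iff_eq, hp] at this
      exact hpq this.symm
    obtain ⟨K, hK1, hK2, hK3⟩ := lerf_iff.1 hG _ ⟨T, rfl⟩ _ hnot
    have hfin : Finite (G ⧸ K) := inferInstance
    refine ⟨Option (G ⧸ K), inferInstance,
      { toFun := fun g => Equiv.optionCongr (MulAction.toPerm g)
        map_one' := by ext x : 1; cases x <;> simp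
        map_mul' := by
          intro g h; ext x : 1; cases x <;> simp [mul_smul] },
      fun x => if ∃ g, ρ g p = x then some (QuotientGroup.mk (a x)) else none, ?_, ?_⟩
    · intro h
      beta_reduce at h
      rw [if_pos ⟨1, by simp⟩, if_pos ho] at h
      rw [Option.some_inj, QuotientGroup.eq] at h
      exact hK3 h
    · intro s hs x hx hsx
      beta_reduce
      by_cases hx2 : ∃ g, ρ g p = x
      · rw [if_pos hx2, if_pos (hstep s x hx2)]
        simp only [MonoidHom.coe_mk, OneHom.coe_mk, Equiv.optionCongr_apply, Option.map_some,
          MulAction.toPerm_apply, MulAction.Quotient.smul_mk, Option.some_inj]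
        rw [QuotientGroup.eq, smul_eq_mul, ← mul_assoc]
        apply hK2
        apply Subgroup.subset_closure
        simp only [T, Finset.coe_image, Set.mem_image, Finset.mem_coe, Finset.mem_filter]
        exact ⟨(s, x), ⟨by simp [hs, hx], hx2⟩, rfl⟩
      · rw [if_neg hx2, if_neg]
        · simp
        · rintro ⟨g, hg⟩
          exact hx2 ⟨s⁻¹ * g, by
            rw [map_mul, Equiv.Perm.mul_apply, map_inv, Equiv.Perm.inv_eq_iff_eq, hg]⟩
  · refine ⟨ULift Prop, inferInstance, 1, fun x => ⟨∃ g, ρ g p = x⟩, ?_, ?_⟩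
    · intro h
      apply ho
      have h2 := congrArg ULift.down h
      simp only [eq_iff_iff] at h2
      exact h2.1 ⟨1, by simp⟩
    · intro s hs x hx hsx
      simp only [MonoidHom.one_apply, Equiv.Perm.coe_one, id]
      congr 1
      rw [eq_iff_iff]
      constructor
      · rintro ⟨g, hg⟩
        exact ⟨s⁻¹ * g, by
            rw [map_mul, Equiv.Perm.mul_apply, map_inv, Equiv.Perm.inv_eq_iff_eq, hg]⟩
      · rintro ⟨g, hg⟩
        exact ⟨s * g, by simp [hg]⟩

theorem lerf_completion {G X : Type u} [Group G] (hG : SubgroupSeparable G)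
    (ρ : G →* Equiv.Perm X) (F : Finset X) (S : Finset G) :
    ∃ (Y : Type u) (_ : Finite Y) (θ : G →* Equiv.Perm Y) (ι : X → Y),
      Set.InjOn ι F ∧ PEquiv' ρ θ F S ι := by
  classical
  have key : ∀ pq : F × F, ∃ (Y : Type u) (_ : Finite Y) (θ : G →* Equiv.Perm Y) (ι : X → Y),
      (pq.1 ≠ pq.2 → ι pq.1 ≠ ι pq.2) ∧ PEquiv' ρ θ F S ι := by
    rintro ⟨p, q⟩
    by_cases h : (p : X) = q
    · refine ⟨PUnit, inferInstance, 1, fun _ => PUnit.unit, ?_, ?_⟩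
      · intro h2; exact absurd (Subtype.ext h) h2
      · intro s _ x _ _; rfl
    · obtain ⟨Y, h1, θ, ι, h2, h3⟩ := lerf_pair hG ρ F S p q h
      exact ⟨Y, h1, θ, ι, fun _ => h2, h3⟩
  choose Y hY θ ι h1 h2 using key
  refine ⟨∀ pq, Y pq, inferInstance,
    { toFun := fun g => Equiv.piCongrRight fun pq => θ pq g
      map_one' := by ext x i; simp
      map_mul' := by intro g h; ext x i; simp }, fun x pq => ι pq x, ?_, ?_⟩
  · intro p hp q hq h
    by_contra hne
    exact h1 (⟨p, hp⟩, ⟨q, hq⟩) (fun h => hne (congrArg Subtype.val h)) (congrFun h _)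
  · intro s hs x hx hsx
    funext pq
    exact h2 pq s hs x hx hsx

theorem coprod_gen {G₁ G₂ X : Type u} [Group G₁] [Group G₂]
    (ρ : Monoid.Coprod G₁ G₂ →* Equiv.Perm X) (g : Monoid.Coprod G₁ G₂) :
    ∀ F : Finset X, ∃ (F' : Finset X) (S₁ : Finset G₁) (S₂ : Finset G₂), F ⊆ F' ∧
      (∀ x ∈ F, ρ g x ∈ F') ∧
      ∀ (Y : Type u) (θ : Monoid.Coprod G₁ G₂ →* Equiv.Perm Y) (ι : X → Y),
        PEquiv' (ρ.comp Monoid.Coprod.inl) (θ.comp Monoid.Coprod.inl) F' S₁ ι →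
        PEquiv' (ρ.comp Monoid.Coprod.inr) (θ.comp Monoid.Coprod.inr) F' S₂ ι →
        ∀ x ∈ F, ι (ρ g x) = θ g (ι x) := by
  classical
  induction g using Monoid.Coprod.induction_on with
  | inl m =>
    intro F
    refine ⟨F ∪ F.image (ρ (Monoid.Coprod.inl m)), {m}, ∅, Finset.subset_union_left, ?_, ?_⟩
    · intro x hx
      exact Finset.mem_union_right _ (Finset.mem_image_of_mem _ hx)
    · intro Y θ ι h1 _ x hx
      exact h1 m (by simp) x (Finset.mem_union_left _ hx)
        (Finset.mem_union_right _ (Finset.mem_image_of_mem _ hx))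
  | inr m =>
    intro F
    refine ⟨F ∪ F.image (ρ (Monoid.Coprod.inr m)), ∅, {m}, Finset.subset_union_left, ?_, ?_⟩
    · intro x hx
      exact Finset.mem_union_right _ (Finset.mem_image_of_mem _ hx)
    · intro Y θ ι _ h1 x hx
      exact h1 m (by simp) x (Finset.mem_union_left _ hx)
        (Finset.mem_union_right _ (Finset.mem_image_of_mem _ hx))
  | mul a b iha ihb =>
    intro F
    obtain ⟨F1, S1, S2, h1, h2, h3⟩ := ihb F
    obtain ⟨F1', S1', S2', h1', h2', h3'⟩ := iha F1
    refine ⟨F1', S1 ∪ S1', S2 ∪ S2', h1.trans h1', ?_, ?_⟩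
    · intro x hx
      rw [map_mul]
      exact h2' _ (h2 x hx)
    · intro Y θ ι k1 k2 x hx
      rw [map_mul, map_mul, Equiv.Perm.mul_apply, Equiv.Perm.mul_apply,
        h3' Y θ ι (k1.mono subset_rfl Finset.subset_union_right)
          (k2.mono subset_rfl Finset.subset_union_right) _ (h2 x hx),
        h3 Y θ ι (k1.mono h1' Finset.subset_union_left)
          (k2.mono h1' Finset.subset_union_left) x hx]

theorem coprod_completion {G₁ G₂ X : Type u} [Group G₁] [Group G₂]
    (hG₁ : SubgroupSeparable G₁) (hG₂ : SubgroupSeparable G₂)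
    (ρ : Monoid.Coprod G₁ G₂ →* Equiv.Perm X) (F : Finset X) (S₁ : Finset G₁) (S₂ : Finset G₂) :
    ∃ (Y : Type u) (_ : Finite Y) (θ : Monoid.Coprod G₁ G₂ →* Equiv.Perm Y) (ι : X → Y),
      Set.InjOn ι F ∧
        PEquiv' (ρ.comp Monoid.Coprod.inl) (θ.comp Monoid.Coprod.inl) F S₁ ι ∧
        PEquiv' (ρ.comp Monoid.Coprod.inr) (θ.comp Monoid.Coprod.inr) F S₂ ι := by
  classical
  obtain ⟨Y1, hf1, θ1, ι1, hi1, he1⟩ := lerf_completion hG₁ (ρ.comp Monoid.Coprod.inl) F S₁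
  obtain ⟨Y2, hf2, θ2, ι2, hi2, he2⟩ := lerf_completion hG₂ (ρ.comp Monoid.Coprod.inr) F S₂
  have := Fintype.ofFinite Y1
  have := Fintype.ofFinite Y2
  let f1 : F → Y1 ⊕ Y2 := fun x => Sum.inl (ι1 x)
  let f2 : F → Y1 ⊕ Y2 := fun x => Sum.inr (ι2 x)
  have hf1 : Function.Injective f1 := fun x y h => Subtype.ext (hi1 x.2 y.2 (Sum.inl_injective h))
  have hf2 : Function.Injective f2 := fun x y h => Subtype.ext (hi2 x.2 y.2 (Sum.inr_injective h))
  let e0 : {y // y ∈ Set.range f1} ≃ {y // y ∈ Set.range f2} :=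
    (Equiv.ofInjective f1 hf1).symm.trans (Equiv.ofInjective f2 hf2)
  let e : Equiv.Perm (Y1 ⊕ Y2) := e0.extendSubtype
  have he : ∀ x ∈ F, e (Sum.inl (ι1 x)) = Sum.inr (ι2 x) := by
    intro x hx
    have := Equiv.extendSubtype_apply_of_mem e0 (f1 ⟨x, hx⟩) ⟨⟨x, hx⟩, rfl⟩
    rw [show (Sum.inl (ι1 x) : Y1 ⊕ Y2) = f1 ⟨x, hx⟩ from rfl]
    refine this.trans ?_
    simp only [e0, Equiv.trans_apply]
    have h2 : (Equiv.ofInjective f1 hf1).symm ⟨f1 ⟨x, hx⟩, ⟨⟨x, hx⟩, rfl⟩⟩ = ⟨x, hx⟩ := by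
      rw [Equiv.symm_apply_eq]; rfl
    rw [h2]; rfl
  let t1 : G₁ →* Equiv.Perm (Y1 ⊕ Y2) :=
    (Equiv.Perm.sumCongrHom Y1 Y2).comp ((MonoidHom.inl _ _).comp θ1)
  let t2 : G₂ →* Equiv.Perm (Y1 ⊕ Y2) :=
    (MulAut.conj e⁻¹).toMonoidHom.comp
      ((Equiv.Perm.sumCongrHom Y1 Y2).comp ((MonoidHom.inr _ _).comp θ2))
  refine ⟨Y1 ⊕ Y2, inferInstance, Monoid.Coprod.lift t1 t2, fun x => Sum.inl (ι1 x), ?_, ?_, ?_⟩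
  · intro x hx y hy h
    exact hi1 hx hy (Sum.inl_injective h)
  · rw [Monoid.Coprod.lift_comp_inl]
    intro s hs x hx hsx
    have := he1 s hs x hx hsx
    simp only [MonoidHom.comp_apply] at this
    simp [this, t1]
  · rw [Monoid.Coprod.lift_comp_inr]
    intro s hs x hx hsx
    have := he2 s hs x hx hsx
    simp only [MonoidHom.comp_apply] at this hsx
    simp only [t2, MonoidHom.comp_apply, MulEquiv.toMonoidHom_eq_coe, MonoidHom.coe_coe,
      MulAut.conj_apply, inv_inv, Equiv.Perm.mul_apply]
    rw [he x hx, Equiv.Perm.eq_inv_iff_eq, he _ hsx, this]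
    simp

theorem lerf_coprod {G₁ G₂ : Type u} [Group G₁] [Group G₂]
    (hG₁ : SubgroupSeparable G₁) (hG₂ : SubgroupSeparable G₂) :
    SubgroupSeparable (Monoid.Coprod G₁ G₂) := by
  classical
  rw [lerf_iff]
  rintro H ⟨T, rfl⟩ g hg
  set H := Subgroup.closure (T : Set (Monoid.Coprod G₁ G₂)) with hH
  let X := Monoid.Coprod G₁ G₂ ⧸ H
  let ρ : Monoid.Coprod G₁ G₂ →* Equiv.Perm X := MulAction.toPermHom _ _
  let x0 : X := QuotientGroup.mk 1
  have hρ : ∀ k, ρ k x0 = x0 ↔ k ∈ H := by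
    intro k
    have h1 : ρ k x0 = QuotientGroup.mk (k * 1) := rfl
    rw [h1, eq_comm, QuotientGroup.eq]; simp
  choose F' S1 S2 h1 h2 h3 using fun g => coprod_gen ρ g {x0}
  let I := insert g T
  obtain ⟨Y, hY, θ, ι, hi, he1, he2⟩ := coprod_completion hG₁ hG₂ ρ (I.biUnion F')
    (I.biUnion S1) (I.biUnion S2)
  have key : ∀ t ∈ I, ι (ρ t x0) = θ t (ι x0) := fun t ht =>
    h3 t Y θ ι (he1.mono (Finset.subset_biUnion_of_mem F' ht) (Finset.subset_biUnion_of_mem S1 ht))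
      (he2.mono (Finset.subset_biUnion_of_mem F' ht) (Finset.subset_biUnion_of_mem S2 ht)) x0
      (by simp)
  refine ⟨(MulAction.stabilizer (Equiv.Perm Y) (ι x0)).comap θ, finiteIndex_comap' _ inferInstance,
    ?_, ?_⟩
  · rw [hH, Subgroup.closure_le]
    intro t ht
    have h := key t (Finset.mem_insert_of_mem ht)
    rw [(hρ t).2 (Subgroup.subset_closure ht)] at h
    exact h.symm
  · intro hmem
    have h : θ g (ι x0) = ι x0 := hmem
    rw [← key g (Finset.mem_insert_self _ _)] at h
    apply hg
    rw [← hρ]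
    refine hi ?_ ?_ h
    · exact Finset.mem_biUnion.2 ⟨g, Finset.mem_insert_self _ _, h2 g x0 (by simp)⟩
    · exact Finset.mem_biUnion.2 ⟨g, Finset.mem_insert_self _ _, h1 g (by simp)⟩


/-! ### Alternating products and homomorphisms from Artin groups -/

theorem altProd_zero {G : Type*} [Monoid G] (u v : G) : altProd u v 0 = 1 := by
  simp [altProd]

theorem altProd_succ {G : Type*} [Monoid G] (u v : G) (n : ℕ) :
    altProd u v (n + 1) = altProd u v n * (if n % 2 = 0 then u else v) := by
  simp [altProd, List.range_succ]

theorem altProd_even {G : Type*} [Monoid G] (u v : G) (k : ℕ) :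
    altProd u v (2 * k) = (u * v) ^ k := by
  induction k with
  | zero => simp [altProd_zero]
  | succ k ih =>
    rw [show 2 * (k + 1) = 2 * k + 1 + 1 by ring, altProd_succ, altProd_succ, ih,
      if_pos (by omega), if_neg (by omega), pow_succ, mul_assoc]

theorem altProd_odd {G : Type*} [Monoid G] (u v : G) (k : ℕ) :
    altProd u v (2 * k + 1) = (u * v) ^ k * u := by
  rw [altProd_succ, altProd_even, if_pos (by omega)]

theorem altProd_two {G : Type*} [Monoid G] (u v : G) : altProd u v 2 = u * v := by
  have := altProd_even u v 1
  simpa using this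

theorem map_altProd {G L : Type*} [Monoid G] [Monoid L] (f : G →* L) (u v : G) (n : ℕ) :
    f (altProd u v n) = altProd (f u) (f v) n := by
  induction n with
  | zero => simp [altProd_zero]
  | succ n ih =>
    rw [altProd_succ, altProd_succ, map_mul, ih]
    split_ifs <;> rfl

/-- the standard generator of an Artin group -/
def aof {V : Type*} (Γ : SimpleGraph V) (ℓ : V → V → ℕ) (v : V) : ArtinGroup Γ ℓ :=
  PresentedGroup.of v

theorem aof_rel {V : Type*} (Γ : SimpleGraph V) (ℓ : V → V → ℕ) {u v : V} (h : Γ.Adj u v) :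
    altProd (aof Γ ℓ u) (aof Γ ℓ v) (ℓ u v) = altProd (aof Γ ℓ v) (aof Γ ℓ u) (ℓ u v) := by
  have h1 : (PresentedGroup.mk (artinRels Γ ℓ))
      (altProd (FreeGroup.of u) (FreeGroup.of v) (ℓ u v) *
        (altProd (FreeGroup.of v) (FreeGroup.of u) (ℓ u v))⁻¹) = 1 :=
    PresentedGroup.one_of_mem ⟨u, v, h, rfl⟩
  rw [map_mul, map_inv, mul_inv_eq_one, map_altProd, map_altProd] at h1
  exact h1

theorem aof_closure {V : Type*} (Γ : SimpleGraph V) (ℓ : V → V → ℕ) :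
    Subgroup.closure (Set.range (aof Γ ℓ)) = ⊤ :=
  PresentedGroup.closure_range_of _

/-- universal property of Artin groups -/
def artinLift {V L : Type*} [Group L] (Γ : SimpleGraph V) (ℓ : V → V → ℕ) (f : V → L)
    (h : ∀ u v, Γ.Adj u v → altProd (f u) (f v) (ℓ u v) = altProd (f v) (f u) (ℓ u v)) :
    ArtinGroup Γ ℓ →* L :=
  PresentedGroup.toGroup (f := f) (by
    rintro r ⟨u, v, huv, rfl⟩
    rw [map_mul, map_inv, mul_inv_eq_one, map_altProd, map_altProd]
    simpa using h u v huv)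

theorem artinLift_aof {V L : Type*} [Group L] (Γ : SimpleGraph V) (ℓ : V → V → ℕ) (f : V → L)
    (h : ∀ u v, Γ.Adj u v → altProd (f u) (f v) (ℓ u v) = altProd (f v) (f u) (ℓ u v)) (v : V) :
    artinLift Γ ℓ f h (aof Γ ℓ v) = f v := by
  simp [artinLift, aof]

theorem artin_hom_ext {V L : Type*} [Group L] {Γ : SimpleGraph V} {ℓ : V → V → ℕ}
    {f g : ArtinGroup Γ ℓ →* L} (h : ∀ v, f (aof Γ ℓ v) = g (aof Γ ℓ v)) : f = g := by
  exact PresentedGroup.ext h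

/-- a homomorphism to the integers sending every generator to `1` -/
def artinLen {V : Type*} (Γ : SimpleGraph V) (ℓ : V → V → ℕ) :
    ArtinGroup Γ ℓ →* Multiplicative ℤ :=
  artinLift Γ ℓ (fun _ => Multiplicative.ofAdd 1) (fun _ _ _ => rfl)

theorem artinLen_aof {V : Type*} (Γ : SimpleGraph V) (ℓ : V → V → ℕ) (v : V) :
    artinLen Γ ℓ (aof Γ ℓ v) = Multiplicative.ofAdd 1 := artinLift_aof ..

/-! ### Dihedral Artin groups -/

theorem exists_zmod_hom {G : Type*} [Group G] (n : ℕ) (g : G) (h : g ^ n = 1) :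
    ∃ f : Multiplicative (ZMod n) →* G, f (Multiplicative.ofAdd 1) = g := by
  let f0 : ℤ →+ Additive G := zmultiplesHom _ (Additive.ofMul g)
  have hf0 : f0 n = 0 := by
    simp only [f0, zmultiplesHom_apply]
    rw [natCast_zsmul]
    exact h
  let f1 : ZMod n →+ Additive G := ZMod.lift n ⟨f0, hf0⟩
  refine ⟨AddMonoidHom.toMultiplicativeLeft f1, ?_⟩
  have h2 : f1 ((1 : ℤ) : ZMod n) = f0 1 := ZMod.lift_coe n ⟨f0, hf0⟩ 1
  have h3 : f0 1 = Additive.ofMul g := by simp [f0]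
  rw [h3] at h2
  simp only [Int.cast_one] at h2
  exact congrArg Additive.toMul h2

theorem lerf_int : SubgroupSeparable (Multiplicative ℤ) :=
  lerf_of_injective (MonoidHom.inr (Multiplicative (ZMod 1)) (Multiplicative ℤ))
    (fun x y h => (Prod.mk.inj h).2) (lerf_prod_int _ (lerf_of_finite _))

theorem lerf_central {A L : Type*} [Group A] [Group L] (hL : SubgroupSeparable L)
    (gens : Set A) (hgen : Subgroup.closure gens = ⊤) (z : A) (hz : ∀ g ∈ gens, g * z = z * g)
    (π : A →* L) (lam : A →* Multiplicative ℤ) (hlam : lam z ≠ 1)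
    (σ : ∀ [(Subgroup.zpowers z).Normal], ∃ f : L →* A ⧸ Subgroup.zpowers z,
      ∀ g ∈ gens, f (π g) = QuotientGroup.mk g) :
    SubgroupSeparable A := by
  have hc : ∀ g : A, g * z = z * g := by
    intro g
    have hg : g ∈ Subgroup.closure gens := by rw [hgen]; trivial
    have : Subgroup.closure gens ≤ Subgroup.centralizer {z} := by
      rw [Subgroup.closure_le]
      intro g hg
      simp only [SetLike.mem_coe, Subgroup.mem_centralizer_singleton_iff]
      exact hz g hg
    exact Subgroup.mem_centralizer_singleton_iff.1 (this hg)
  have hn : (Subgroup.zpowers z).Normal := by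
    constructor
    rintro _ ⟨n, rfl⟩ g
    have : Commute g (z ^ n) := Commute.zpow_right (hc g) n
    simp only
    rw [this.eq]; simp
  obtain ⟨f, hf⟩ := σ
  have hcomp : f.comp π = QuotientGroup.mk' _ := MonoidHom.eq_of_eqOn_dense hgen hf
  refine lerf_of_injective (π.prod lam) ?_ (lerf_prod_int L hL)
  rw [injective_iff_map_eq_one]
  intro x hx
  have h1 : π x = 1 := congrArg Prod.fst hx
  have h2 : lam x = 1 := congrArg Prod.snd hx
  have h3 : (QuotientGroup.mk' (Subgroup.zpowers z)) x = 1 := by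
    rw [← hcomp, MonoidHom.comp_apply, h1, map_one]
  rw [QuotientGroup.mk'_apply, QuotientGroup.eq_one_iff] at h3
  obtain ⟨n, rfl⟩ := h3
  simp only [map_zpow] at h2
  have h4 : n • (lam z).toAdd = 0 := congrArg Multiplicative.toAdd h2
  rcases smul_eq_zero.1 h4 with h5 | h5
  · simp [h5]
  · exact absurd (Multiplicative.toAdd.injective h5) hlam

theorem dihedral_lerf {V : Type*} (Γ : SimpleGraph V) (ℓ : V → V → ℕ)
    (hsymm : ∀ u v, ℓ u v = ℓ v u) (u v : V) (hne : u ≠ v)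
    (hall : ∀ w, w = u ∨ w = v) (hadj : Γ.Adj u v) (hm : 2 ≤ ℓ u v) :
    SubgroupSeparable (ArtinGroup Γ ℓ) := by
  classical
  set a := aof Γ ℓ u with ha
  set b := aof Γ ℓ v with hb
  have hrel : altProd a b (ℓ u v) = altProd b a (ℓ u v) := aof_rel Γ ℓ hadj
  have hgen : Subgroup.closure {a, b} = ⊤ := by
    rw [← aof_closure Γ ℓ]
    congr 1
    ext x
    constructor
    · rintro (rfl | rfl)
      exacts [⟨u, rfl⟩, ⟨v, rfl⟩]
    · rintro ⟨w, rfl⟩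
      rcases hall w with rfl | rfl
      exacts [Or.inl rfl, Or.inr rfl]
  have lift : ∀ {L : Type} [Group L] (x y : L), altProd x y (ℓ u v) = altProd y x (ℓ u v) →
      ∃ f : ArtinGroup Γ ℓ →* L, f a = x ∧ f b = y := by
    intro L _ x y h
    refine ⟨artinLift Γ ℓ (fun w => if w = u then x else y) ?_, ?_, ?_⟩
    · intro w1 w2 hw
      rcases hall w1 with rfl | rfl <;> rcases hall w2 with rfl | rfl
      · rfl
      · rw [if_pos rfl, if_neg hne.symm]; exact h
      · rw [if_pos rfl, if_neg hne.symm, hsymm]; exact h.symm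
      · rfl
    · exact (artinLift_aof ..).trans (if_pos rfl)
    · exact (artinLift_aof ..).trans (if_neg hne.symm)
  have hlen : ∀ n, n ≠ 0 → artinLen Γ ℓ ((a * b) ^ n) ≠ 1 := by
    intro n hn h
    rw [map_pow, map_mul, ha, hb, artinLen_aof, artinLen_aof] at h
    have h2 : n • ((1 : ℤ) + 1) = 0 := congrArg Multiplicative.toAdd h
    simp at h2
    exact hn h2
  rcases Nat.even_or_odd' (ℓ u v) with ⟨k, hk | hk⟩
  · -- even label
    rw [hk, altProd_even, altProd_even] at hrel
    have hk0 : k ≠ 0 := by omega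
    have : NeZero k := ⟨hk0⟩
    let L := Monoid.Coprod (Multiplicative ℤ) (Multiplicative (ZMod k))
    let s : L := Monoid.Coprod.inl (Multiplicative.ofAdd 1)
    let y : L := Monoid.Coprod.inr (Multiplicative.ofAdd 1)
    have hy : y ^ k = 1 := by
      simp only [y]
      rw [← map_pow, ← ofAdd_nsmul]
      simp
    obtain ⟨π, h1, h2⟩ := lift s (s⁻¹ * y) (by
      rw [hk, altProd_even, altProd_even]
      have e : s⁻¹ * y * s = s⁻¹ * y * s⁻¹⁻¹ := by rw [inv_inv]
      rw [e, conj_pow, mul_inv_cancel_left, hy]; simp)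
    refine lerf_central (L := L) (lerf_coprod lerf_int (lerf_of_finite _)) {a, b} hgen ((a * b) ^ k)
      ?_ π (artinLen Γ ℓ) (hlen k hk0) ?_
    · rintro g (rfl | rfl)
      · calc a * (a * b) ^ k = a * (b * a) ^ k := by rw [hrel]
          _ = (a * b) ^ k * a := (SemiconjBy.pow_right (show SemiconjBy a (b * a) (a * b) from
            (mul_assoc _ _ _).symm) k)
      · calc b * (a * b) ^ k = (b * a) ^ k * b :=
            (SemiconjBy.pow_right (show SemiconjBy b (a * b) (b * a) from
            (mul_assoc _ _ _).symm) k)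
          _ = (a * b) ^ k * b := by rw [hrel]
    · intro hn
      obtain ⟨f2, hf2⟩ := exists_zmod_hom k
        (QuotientGroup.mk (a * b) : ArtinGroup Γ ℓ ⧸ Subgroup.zpowers ((a * b) ^ k)) (by
          rw [← QuotientGroup.mk_pow, QuotientGroup.eq_one_iff]
          exact Subgroup.mem_zpowers _)
      refine ⟨Monoid.Coprod.lift (zpowersHom _ (QuotientGroup.mk a)) f2, ?_⟩
      have e1 : Monoid.Coprod.lift (zpowersHom _ (QuotientGroup.mk a)) f2 s
          = (QuotientGroup.mk a : ArtinGroup Γ ℓ ⧸ Subgroup.zpowers ((a * b) ^ k)) := by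
        simp [s]
      have e2 : Monoid.Coprod.lift (zpowersHom _ (QuotientGroup.mk a)) f2 y
          = (QuotientGroup.mk (a * b) : ArtinGroup Γ ℓ ⧸ Subgroup.zpowers ((a * b) ^ k)) := by
        simp only [y, Monoid.Coprod.lift_apply_inr, hf2]
      rintro g (rfl | rfl)
      · rw [h1, e1]
      · rw [h2, map_mul, map_inv, e1, e2, QuotientGroup.mk_mul, inv_mul_cancel_left]
  · -- odd label
    rw [hk, altProd_odd, altProd_odd] at hrel
    let m := 2 * k + 1
    have hm0 : m ≠ 0 := by omega
    have : NeZero m := ⟨hm0⟩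
    let L := Monoid.Coprod (Multiplicative (ZMod 2)) (Multiplicative (ZMod m))
    let s : L := Monoid.Coprod.inl (Multiplicative.ofAdd 1)
    let y : L := Monoid.Coprod.inr (Multiplicative.ofAdd 1)
    have hy : y ^ m = 1 := by
      simp only [y]
      rw [← map_pow, ← ofAdd_nsmul]
      simp
    have hs : s ^ 2 = 1 := by
      simp only [s]
      rw [← map_pow, ← ofAdd_nsmul]
      simp [show ((2 : ZMod 2)) = 0 from rfl]
    have hs' : s⁻¹ = s := by
      rw [inv_eq_iff_mul_eq_one, ← pow_two, hs]
    obtain ⟨π, h1, h2⟩ := lift ((y ^ k)⁻¹ * s) (s⁻¹ * y ^ (k + 1)) (by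
      rw [hk, altProd_odd, altProd_odd]
      have e1 : (y ^ k)⁻¹ * s * (s⁻¹ * y ^ (k + 1)) = y := by
        rw [pow_succ]; group
      have e2 : (s⁻¹ * y ^ (k + 1) * ((y ^ k)⁻¹ * s)) = s⁻¹ * y * s⁻¹⁻¹ := by
        rw [pow_succ', mul_assoc, mul_assoc, mul_inv_cancel_left, inv_inv, mul_assoc]
      rw [e1, e2, conj_pow, inv_inv, mul_inv_cancel_left]
      have : s⁻¹ * y ^ k * s * (s⁻¹ * y ^ (k + 1)) = s⁻¹ * y ^ m := by
        simp only [m]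
        rw [two_mul, add_assoc, pow_add y k (k + 1)]; group
      rw [this, hy, mul_one, hs'])
    have hΔa : SemiconjBy ((a * b) ^ k * a) a b := by
      show (a * b) ^ k * a * a = b * ((a * b) ^ k * a)
      calc (a * b) ^ k * a * a = (b * a) ^ k * b * a := by rw [hrel]
        _ = b * (a * b) ^ k * a := by
          rw [(SemiconjBy.pow_right (show SemiconjBy b (a * b) (b * a) from
            (mul_assoc _ _ _).symm) k).eq]
        _ = _ := by rw [mul_assoc]
    have hΔb : SemiconjBy ((a * b) ^ k * a) b a := by
      show (a * b) ^ k * a * b = a * ((a * b) ^ k * a)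
      calc (a * b) ^ k * a * b = a * (b * a) ^ k * b := by
            rw [(SemiconjBy.pow_right (show SemiconjBy a (b * a) (a * b) from
              (mul_assoc _ _ _).symm) k).eq]
        _ = _ := by rw [mul_assoc, hrel]
    have hz : (a * b) ^ m = ((a * b) ^ k * a) * ((a * b) ^ k * a) := by
      calc (a * b) ^ m = (a * b) ^ k * (a * b) ^ k * (a * b) := by
            simp only [m]; rw [pow_succ, two_mul, pow_add]
        _ = (a * b) ^ k * (a * (b * a) ^ k * b) := by
            rw [(SemiconjBy.pow_right (show SemiconjBy a (b * a) (a * b) from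
              (mul_assoc _ _ _).symm) k).eq]; simp only [mul_assoc]
        _ = _ := by rw [mul_assoc a, ← hrel]; simp only [mul_assoc]
    refine lerf_central (L := L) (lerf_coprod (lerf_of_finite _) (lerf_of_finite _)) {a, b} hgen
      ((a * b) ^ m) ?_ π (artinLen Γ ℓ) (hlen m hm0) ?_
    · rintro g (rfl | rfl)
      · rw [hz]; exact (hΔb.mul_left hΔa).eq.symm
      · rw [hz]; exact (hΔa.mul_left hΔb).eq.symm
    · intro hn
      obtain ⟨f2, hf2⟩ := exists_zmod_hom m
        (QuotientGroup.mk (a * b) : ArtinGroup Γ ℓ ⧸ Subgroup.zpowers ((a * b) ^ m)) (by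
          rw [← QuotientGroup.mk_pow, QuotientGroup.eq_one_iff]
          exact Subgroup.mem_zpowers _)
      obtain ⟨f1, hf1⟩ := exists_zmod_hom 2
        (QuotientGroup.mk ((a * b) ^ k * a) : ArtinGroup Γ ℓ ⧸ Subgroup.zpowers ((a * b) ^ m)) (by
          rw [← QuotientGroup.mk_pow, QuotientGroup.eq_one_iff, pow_two, ← hz]
          exact Subgroup.mem_zpowers _)
      refine ⟨Monoid.Coprod.lift f1 f2, ?_⟩
      have e1 : Monoid.Coprod.lift f1 f2 s
          = (QuotientGroup.mk ((a * b) ^ k * a) :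
              ArtinGroup Γ ℓ ⧸ Subgroup.zpowers ((a * b) ^ m)) := by
        simp only [s, Monoid.Coprod.lift_apply_inl, hf1]
      have e2 : Monoid.Coprod.lift f1 f2 y
          = (QuotientGroup.mk (a * b) : ArtinGroup Γ ℓ ⧸ Subgroup.zpowers ((a * b) ^ m)) := by
        simp only [y, Monoid.Coprod.lift_apply_inr, hf2]
      rintro g (rfl | rfl)
      · rw [h1, map_mul, map_inv, map_pow, e1, e2, ← QuotientGroup.mk_pow, ← QuotientGroup.mk_inv,
          ← QuotientGroup.mk_mul, inv_mul_cancel_left]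
      · rw [h2, map_mul, map_inv, map_pow, e1, e2, ← QuotientGroup.mk_pow, ← QuotientGroup.mk_inv,
          ← QuotientGroup.mk_mul]
        congr 1
        rw [pow_succ]; group


/-! ### Combinatorics of the forbidden subgraphs -/

/-- a triple spanning a forbidden `P₃` or triangle -/
def BadTriple {V : Type*} (Γ : SimpleGraph V) (ℓ : V → V → ℕ) (a b c : V) : Prop :=
  a ≠ c ∧ Γ.Adj a b ∧ Γ.Adj b c ∧ 3 ≤ ℓ a b ∧ ¬ (Γ.Adj a c ∧ ℓ b c = 2 ∧ ℓ a c = 2)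

/-- a quadruple spanning a forbidden `P₄`, `C₄` or chordal square -/
def BadSquare {V : Type*} (Γ : SimpleGraph V) (ℓ : V → V → ℕ) (a b c d : V) : Prop :=
  a ≠ c ∧ b ≠ d ∧ a ≠ d ∧ Γ.Adj a b ∧ Γ.Adj b c ∧ Γ.Adj c d ∧
    ℓ a b = 2 ∧ ℓ b c = 2 ∧ ℓ c d = 2 ∧
    (Γ.Adj a c → 3 ≤ ℓ a c) ∧ (Γ.Adj b d → 3 ≤ ℓ b d) ∧ (Γ.Adj a d → ℓ a d = 2)

theorem comb_structure {V : Type*} [Fintype V] [Nonempty V] (Γ : SimpleGraph V) (ℓ : V → V → ℕ)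
    (hsymm : ∀ u v, ℓ u v = ℓ v u) (hge : ∀ u v, Γ.Adj u v → 2 ≤ ℓ u v)
    (hT : ∀ a b c, ¬ BadTriple Γ ℓ a b c) (hS : ∀ a b c d, ¬ BadSquare Γ ℓ a b c d) :
    (∃ v, ∀ w, w ≠ v → Γ.Adj v w ∧ ℓ v w = 2) ∨
    (∃ S : Set V, S.Nonempty ∧ Sᶜ.Nonempty ∧ ∀ x ∈ S, ∀ y ∉ S, ¬ Γ.Adj x y) ∨
    (∃ u v, u ≠ v ∧ (∀ w, w = u ∨ w = v) ∧ Γ.Adj u v) := by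
  classical
  obtain ⟨v, hv⟩ := Finite.exists_max
    (fun v : V => (Finset.univ.filter (fun x => x = v ∨ Γ.Adj v x)).card)
  -- labels are 2 near non-adjacent pairs
  have lab : ∀ x y z, x ≠ z → Γ.Adj x y → Γ.Adj y z → ¬ Γ.Adj x z → ℓ x y = 2 := by
    intro x y z hxz h1 h2 h3
    by_contra h
    have := hge x y h1
    exact hT x y z ⟨hxz, h1, h2, by omega, fun h => h3 h.1⟩
  by_cases hdom : ∀ w, w ≠ v → Γ.Adj v w
  · by_cases hl : ∀ w, w ≠ v → ℓ v w = 2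
    · exact Or.inl ⟨v, fun w hw => ⟨hdom w hw, hl w hw⟩⟩
    · push Not at hl
      obtain ⟨u, huv, hu⟩ := hl
      have hu3 : 3 ≤ ℓ v u := by have := hge v u (hdom u huv); omega
      by_cases hall : ∀ w, w = v ∨ w = u
      · exact Or.inr (Or.inr ⟨v, u, huv.symm, hall, hdom u huv⟩)
      · push Not at hall
        obtain ⟨w, hwv, hwu⟩ := hall
        have key : ∀ x, x ≠ v → x ≠ u → Γ.Adj u x ∧ ℓ v x = 2 ∧ ℓ u x = 2 := by
          intro x hxv hxu
          by_contra h
          exact hT u v x ⟨hxu.symm, (hdom u huv).symm, hdom x hxv, by rw [hsymm]; exact hu3, h⟩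
        obtain ⟨h1, h2, h3⟩ := key w hwv hwu
        refine Or.inl ⟨w, fun x hx => ?_⟩
        by_cases hxv : x = v
        · subst hxv; exact ⟨(hdom w hwv).symm, by rw [hsymm]; exact h2⟩
        by_cases hxu : x = u
        · subst hxu; exact ⟨h1.symm, by rw [hsymm]; exact h3⟩
        obtain ⟨k1, k2, k3⟩ := key x hxv hxu
        by_contra hcon
        refine hS v w u x ⟨huv.symm, hx.symm, fun h => hxv h.symm, hdom w hwv, h1.symm, k1, h2,
          by rw [hsymm]; exact h3, k3, fun _ => hu3, ?_, fun _ => k2⟩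
        intro h
        have := hge w x h
        by_contra h4
        exact hcon ⟨h, by omega⟩
  · push Not at hdom
    obtain ⟨w0, hw0, hw0v⟩ := hdom
    by_cases hcr : ∀ x ∈ {x | x = v ∨ Γ.Adj v x}, ∀ y ∉ {x | x = v ∨ Γ.Adj v x}, ¬ Γ.Adj x y
    · refine Or.inr (Or.inl ⟨{x | x = v ∨ Γ.Adj v x}, ⟨v, Or.inl rfl⟩, ⟨w0, ?_⟩, hcr⟩)
      rintro (h | h)
      exacts [hw0 h, hw0v h]
    · exfalso
      push Not at hcr
      obtain ⟨u, hu, w, hw, huw⟩ := hcr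
      simp only [Set.mem_setOf_eq, not_or] at hu hw
      have hvu : Γ.Adj v u := by
        rcases hu with rfl | hu
        · exact absurd huw hw.2
        · exact hu
      have hx : ∃ x, (x = v ∨ Γ.Adj v x) ∧ ¬ (x = u ∨ Γ.Adj u x) := by
        by_contra hcon
        push Not at hcon
        have hlt : (Finset.univ.filter (fun x => x = v ∨ Γ.Adj v x)).card <
            (Finset.univ.filter (fun x => x = u ∨ Γ.Adj u x)).card := by
          apply Finset.card_lt_card
          rw [Finset.ssubset_iff_of_subset]
          · exact ⟨w, by simp [huw], by simp [hw]⟩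
          · intro x hx
            simp only [Finset.mem_filter, Finset.mem_univ, true_and] at hx ⊢
            by_cases h : x = u
            · exact Or.inl h
            · exact Or.inr (by
                rcases hcon x hx with h2 | h2
                · exact absurd h2 h
                · exact h2)
        exact absurd (hv u) (not_le.2 hlt)
      obtain ⟨x, hx1, hx2⟩ := hx
      push Not at hx2
      have hxv : x ≠ v := by
        rintro rfl; exact hx2.2 hvu.symm
      have hvx : Γ.Adj v x := hx1.resolve_left hxv
      have hxw : x ≠ w := by
        rintro rfl; exact hw.2 hvx
      refine hS x v u w ⟨hx2.1, fun h => hw.1 h.symm, hxw, hvx.symm, hvu, huw, ?_, ?_, ?_,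
        fun h => absurd h.symm hx2.2, fun h => absurd h hw.2, ?_⟩
      · exact lab x v u hx2.1 hvx.symm hvu (fun h => hx2.2 h.symm)
      · exact lab v u w (fun h => hw.1 h.symm) hvu huw hw.2
      · rw [hsymm]; exact lab w u v hw.1 huw.symm hvu.symm (fun h => hw.2 h.symm)
      · intro h
        rw [hsymm]; exact lab w x v hw.1 h.symm hvx.symm (fun h => hw.2 h.symm)

/-! ### Separability in the absence of forbidden subgraphs -/

/-- restriction of a labeling -/
def resLab {V : Type*} (ℓ : V → V → ℕ) (S : Set V) : S → S → ℕ := fun x y => ℓ x y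

/-- inclusion of a special subgroup -/
def artinIncl {V : Type*} (Γ : SimpleGraph V) (ℓ : V → V → ℕ) (S : Set V) :
    ArtinGroup (Γ.induce S) (resLab ℓ S) →* ArtinGroup Γ ℓ :=
  artinLift _ _ (fun x => aof Γ ℓ x) (fun u v h => aof_rel Γ ℓ (u := u) (v := v) h)

theorem artinIncl_aof {V : Type*} (Γ : SimpleGraph V) (ℓ : V → V → ℕ) (S : Set V) (x : S) :
    artinIncl Γ ℓ S (aof _ _ x) = aof Γ ℓ x := artinLift_aof ..

theorem lerf_cone {V : Type*} (Γ : SimpleGraph V) (ℓ : V → V → ℕ)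
    (hsymm : ∀ u v, ℓ u v = ℓ v u) (v : V) (hv : ∀ w, w ≠ v → Γ.Adj v w ∧ ℓ v w = 2)
    (h : SubgroupSeparable (ArtinGroup (Γ.induce {v}ᶜ) (resLab ℓ {v}ᶜ))) :
    SubgroupSeparable (ArtinGroup Γ ℓ) := by
  classical
  have hcomm : ∀ w, w ≠ v → Commute (aof Γ ℓ w) (aof Γ ℓ v) := by
    intro w hw
    have := aof_rel Γ ℓ (hv w hw).1
    rw [(hv w hw).2, altProd_two, altProd_two] at this
    exact this.symm
  let S : Set V := {v}ᶜ
  let A' := ArtinGroup (Γ.induce S) (resLab ℓ S)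
  let f0 : V → A' × Multiplicative ℤ := fun w =>
    if hw : w = v then (1, Multiplicative.ofAdd 1)
    else (aof (Γ.induce S) (resLab ℓ S) ⟨w, hw⟩, 1)
  have f0v : f0 v = (1, Multiplicative.ofAdd 1) := by simp [f0]
  have f0w : ∀ w (hw : w ≠ v), f0 w = (aof (Γ.induce S) (resLab ℓ S) ⟨w, hw⟩, 1) := by
    intro w hw; simp [f0, hw]
  have hf0 : ∀ x y, Γ.Adj x y → altProd (f0 x) (f0 y) (ℓ x y) = altProd (f0 y) (f0 x) (ℓ x y) := by
    intro x y hxy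
    by_cases hx : x = v
    · subst hx
      have hy : y ≠ x := hxy.ne'
      rw [(hv y hy).2, altProd_two, altProd_two, f0v, f0w y hy]
      simp
    by_cases hy : y = v
    · subst hy
      rw [hsymm, (hv x hx).2, altProd_two, altProd_two, f0v, f0w x hx]
      simp
    rw [f0w x hx, f0w y hy]
    have e : ∀ z : A', ((z, 1) : A' × Multiplicative ℤ) = MonoidHom.inl A' (Multiplicative ℤ) z :=
      fun z => rfl
    rw [e, e, ← map_altProd, ← map_altProd]
    congr 1
    exact aof_rel (Γ.induce S) (resLab ℓ S) (u := ⟨x, hx⟩) (v := ⟨y, hy⟩) hxy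
  let f := artinLift Γ ℓ f0 hf0
  have hc : ∀ (m : A') (n : Multiplicative ℤ),
      Commute (artinIncl Γ ℓ S m) (zpowersHom _ (aof Γ ℓ v) n) := by
    intro m n
    have hm : m ∈ Subgroup.closure (Set.range (aof (Γ.induce S) (resLab ℓ S))) := by
      rw [aof_closure]; trivial
    rw [zpowersHom_apply]
    apply Commute.zpow_right
    induction hm using Subgroup.closure_induction with
    | mem m hm =>
      obtain ⟨x, rfl⟩ := hm
      rw [artinIncl_aof]
      exact hcomm x x.2
    | one => rw [map_one]; exact Commute.one_left _
    | mul a b _ _ h1 h2 => rw [map_mul]; exact h1.mul_left h2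
    | inv a _ h1 => rw [map_inv]; exact h1.inv_left
  let g := MonoidHom.noncommCoprod (artinIncl Γ ℓ S) (zpowersHom _ (aof Γ ℓ v)) hc
  have hgf : g.comp f = MonoidHom.id _ := by
    apply artin_hom_ext
    intro w
    rw [MonoidHom.comp_apply]
    simp only [f, g]
    rw [artinLift_aof]
    by_cases hw : w = v
    · subst hw
      rw [f0v]; simp
    · rw [f0w w hw, MonoidHom.noncommCoprod_apply, artinIncl_aof]; simp
  refine lerf_of_injective f ?_ (lerf_prod_int A' h)
  exact Function.LeftInverse.injective (g := g) (fun x => DFunLike.congr_fun hgf x)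

theorem lerf_disj {V : Type u} (Γ : SimpleGraph V) (ℓ : V → V → ℕ) (S : Set V)
    (hS : ∀ x ∈ S, ∀ y ∉ S, ¬ Γ.Adj x y)
    (h1 : SubgroupSeparable (ArtinGroup (Γ.induce S) (resLab ℓ S)))
    (h2 : SubgroupSeparable (ArtinGroup (Γ.induce Sᶜ) (resLab ℓ Sᶜ))) :
    SubgroupSeparable (ArtinGroup Γ ℓ) := by
  classical
  let A₁ := ArtinGroup (Γ.induce S) (resLab ℓ S)
  let A₂ := ArtinGroup (Γ.induce Sᶜ) (resLab ℓ Sᶜ)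
  let f0 : V → Monoid.Coprod A₁ A₂ := fun w =>
    if hw : w ∈ S then Monoid.Coprod.inl (aof (Γ.induce S) (resLab ℓ S) ⟨w, hw⟩)
    else Monoid.Coprod.inr (aof (Γ.induce Sᶜ) (resLab ℓ Sᶜ) ⟨w, hw⟩)
  have f01 : ∀ w (hw : w ∈ S),
      f0 w = Monoid.Coprod.inl (aof (Γ.induce S) (resLab ℓ S) ⟨w, hw⟩) := by
    intro w hw; simp [f0, hw]
  have f02 : ∀ w (hw : w ∉ S),
      f0 w = Monoid.Coprod.inr (aof (Γ.induce Sᶜ) (resLab ℓ Sᶜ) ⟨w, hw⟩) := by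
    intro w hw; simp [f0, hw]
  have hf0 : ∀ x y, Γ.Adj x y → altProd (f0 x) (f0 y) (ℓ x y) = altProd (f0 y) (f0 x) (ℓ x y) := by
    intro x y hxy
    by_cases hx : x ∈ S <;> by_cases hy : y ∈ S
    · rw [f01 x hx, f01 y hy, ← map_altProd, ← map_altProd]
      congr 1
      exact aof_rel (Γ.induce S) (resLab ℓ S) (u := ⟨x, hx⟩) (v := ⟨y, hy⟩) hxy
    · exact absurd hxy (hS x hx y hy)
    · exact absurd hxy.symm (hS y hy x hx)
    · rw [f02 x hx, f02 y hy, ← map_altProd, ← map_altProd]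
      congr 1
      exact aof_rel (Γ.induce Sᶜ) (resLab ℓ Sᶜ) (u := ⟨x, hx⟩) (v := ⟨y, hy⟩) hxy
  let f := artinLift Γ ℓ f0 hf0
  let g := Monoid.Coprod.lift (artinIncl Γ ℓ S) (artinIncl Γ ℓ Sᶜ)
  have hgf : g.comp f = MonoidHom.id _ := by
    apply artin_hom_ext
    intro w
    rw [MonoidHom.comp_apply]
    simp only [f, g]
    rw [artinLift_aof]
    by_cases hw : w ∈ S
    · rw [f01 w hw, Monoid.Coprod.lift_apply_inl, artinIncl_aof]; simp
    · rw [f02 w hw, Monoid.Coprod.lift_apply_inr, artinIncl_aof]; simp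
  refine lerf_of_injective f ?_ (lerf_coprod (G₁ := A₁) (G₂ := A₂) h1 h2)
  exact Function.LeftInverse.injective (g := g) (fun x => DFunLike.congr_fun hgf x)

theorem lerf_of_no_bad (n : ℕ) : ∀ {V : Type u} [Fintype V] (_ : Fintype.card V ≤ n)
    (Γ : SimpleGraph V) (ℓ : V → V → ℕ)
    (_ : ∀ u v, ℓ u v = ℓ v u) (_ : ∀ u v, Γ.Adj u v → 2 ≤ ℓ u v)
    (_ : ∀ a b c, ¬ BadTriple Γ ℓ a b c) (_ : ∀ a b c d, ¬ BadSquare Γ ℓ a b c d),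
    SubgroupSeparable (ArtinGroup Γ ℓ) := by
  classical
  have hempty : ∀ {V : Type u} [IsEmpty V] (Γ : SimpleGraph V) (ℓ : V → V → ℕ),
      SubgroupSeparable (ArtinGroup Γ ℓ) := by
    intro V _ Γ ℓ
    have : Subsingleton (ArtinGroup Γ ℓ) := by
      refine ⟨fun x y => ?_⟩
      have : (MonoidHom.id (ArtinGroup Γ ℓ)) = 1 := artin_hom_ext (fun v => isEmptyElim v)
      exact (DFunLike.congr_fun this x).trans (DFunLike.congr_fun this y).symm
    exact lerf_of_finite _
  induction n with
  | zero =>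
    intro V _ hc Γ ℓ _ _ _ _
    have : IsEmpty V := Fintype.card_eq_zero_iff.1 (by omega)
    exact hempty Γ ℓ
  | succ n ih =>
    intro V _ hc Γ ℓ hsymm hge hT hS
    rcases isEmpty_or_nonempty V with hV | hV
    · exact hempty Γ ℓ
    have sub : ∀ S : Set V, Sᶜ.Nonempty →
        SubgroupSeparable (ArtinGroup (Γ.induce S) (resLab ℓ S)) := by
      intro S hSc
      refine ih ?_ _ _ (fun u v => hsymm u v) (fun u v h => hge u v h) ?_ ?_
      · obtain ⟨x, hx⟩ := hSc
        have := Fintype.card_subtype_lt (p := fun y => y ∈ S) hx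
        have h2 : Fintype.card S = Fintype.card {y // y ∈ S} := Fintype.card_congr (Equiv.refl _)
        omega
      · rintro a b c ⟨k1, k2, k3, k4, k5⟩
        exact hT a b c ⟨fun h => k1 (Subtype.ext h), k2, k3, k4, k5⟩
      · rintro a b c d ⟨k1, k2, k3, k4, k5⟩
        exact hS a b c d ⟨fun h => k1 (Subtype.ext h), fun h => k2 (Subtype.ext h),
          fun h => k3 (Subtype.ext h), k4, k5⟩
    rcases comb_structure Γ ℓ hsymm hge hT hS with ⟨v, hv⟩ | ⟨S, h1, h2, h3⟩ | ⟨u, v, h1, h2, h3⟩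
    · exact lerf_cone Γ ℓ hsymm v hv (sub _ (by simp))
    · exact lerf_disj Γ ℓ S h3 (sub S h2) (sub Sᶜ (by simpa using h1))
    · exact dihedral_lerf Γ ℓ hsymm u v h1 h2 h3 (hge u v h3)


/-! ### A criterion for non-separability -/

theorem loop_fix {G X : Type*} [Group G] [MulAction G X] {A B C D : G} (hAB : Commute A B)
    (hBC : Commute B C) (hCD : Commute C D) (x₀ x₁ : X) (hA : A • x₁ = x₀) (hD : D • x₀ = x₁)
    (hC : C • x₀ = B • x₀) (h23 : C ^ 2 • x₁ = B ^ 3 • x₁) (hn : ∃ n : ℕ, 0 < n ∧ B ^ n • x₀ = x₀) :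
    ((C * (A * C * A⁻¹))⁻¹ * ((A * C * A⁻¹) * C)) • x₀ = x₀ := by
  classical
  have hCpow : ∀ k : ℕ, C ^ k • x₀ = B ^ k • x₀ := by
    intro k
    induction k with
    | zero => simp
    | succ k ih =>
      rw [pow_succ, mul_smul, hC, ← mul_smul, ((hBC.symm.pow_left k).eq), mul_smul, ih,
        ← mul_smul, ← pow_succ']
  have h23p : ∀ k : ℕ, C ^ (2 * k) • x₁ = B ^ (3 * k) • x₁ := by
    intro k
    induction k with
    | zero => simp
    | succ k ih =>
      rw [show 2 * (k + 1) = 2 * k + 2 by ring, pow_add, mul_smul, h23, ← mul_smul,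
        ((hBC.symm.pow_pow (2 * k) 3).eq), mul_smul, ih, ← mul_smul, ← pow_add]
      congr 2; ring
  have hB1 : ∀ k : ℕ, B ^ k • x₁ = x₁ → B ^ k • x₀ = x₀ := by
    intro k hk
    rw [← hA, ← mul_smul, ← (hAB.pow_right k).eq, mul_smul, hk]
  have hC1 : ∀ k : ℕ, C ^ k • x₀ = x₀ → C ^ k • x₁ = x₁ := by
    intro k hk
    rw [← hD, ← mul_smul, (hCD.pow_left k).eq, mul_smul, hk]
  have hn1 := (Nat.find_spec hn)
  set n := Nat.find hn with hndef
  have hodd : ∃ j, C • x₁ = B ^ j • x₁ := by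
    rcases Nat.even_or_odd' n with ⟨k, hk | hk⟩
    · exfalso
      have h1 : B ^ (2 * k) • x₀ = x₀ := by rw [← hk]; exact hn1.2
      have h2 : C ^ (2 * k) • x₁ = x₁ := hC1 _ (by rw [hCpow, h1])
      rw [h23p] at h2
      have h3 := hB1 _ h2
      rw [show 3 * k = k + 2 * k by ring, pow_add, mul_smul, h1] at h3
      have := Nat.find_min hn (m := k) (by omega)
      exact this ⟨by omega, h3⟩
    · have h1 : C ^ n • x₁ = x₁ := hC1 _ (by rw [hCpow]; exact hn1.2)
      refine ⟨3 * (k + 1), ?_⟩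
      rw [← h23p, show 2 * (k + 1) = 1 + n by omega, pow_add, mul_smul, h1, pow_one]
  obtain ⟨j, hj⟩ := hodd
  have hW : (A * C * A⁻¹) • x₀ = B ^ j • x₀ := by
    rw [mul_smul, mul_smul, ← hA, inv_smul_smul, hj, ← mul_smul, (hAB.pow_right j).eq, mul_smul]
  have hBW : Commute B (A * C * A⁻¹) := (hAB.symm.mul_right hBC).mul_right hAB.symm.inv_right
  rw [mul_smul, inv_smul_eq_iff, mul_smul _ C, hC, ← mul_smul, ← hBW.eq, mul_smul B, hW,
    mul_smul C, hW, ← mul_smul C, (hBC.symm.pow_right j).eq, mul_smul _ C, hC, ← mul_smul,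
    ← mul_smul, ← pow_succ, ← pow_succ']

/-- translation on the rationals -/
def trA : Equiv.Perm ℚ := Equiv.addRight 1

/-- a permutation of the rationals conjugating `x ↦ x + 2` to `x ↦ x + 3` -/
def trT : Equiv.Perm ℚ where
  toFun x := 3 * ⌊x / 2⌋ + (if x - 2 * ⌊x / 2⌋ ≤ 1 then x - 2 * ⌊x / 2⌋
    else 2 * (x - 2 * ⌊x / 2⌋) - 1)
  invFun x := 2 * ⌊x / 3⌋ + (if x - 3 * ⌊x / 3⌋ ≤ 1 then x - 3 * ⌊x / 3⌋
    else ((x - 3 * ⌊x / 3⌋) + 1) / 2)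
  left_inv x := by
    beta_reduce
    have h1 := Int.floor_le (x / 2)
    have h2 := Int.lt_floor_add_one (x / 2)
    generalize ⌊x / 2⌋ = k at *
    have hf : ⌊(3 * (k : ℚ) + (if x - 2 * k ≤ 1 then x - 2 * k else 2 * (x - 2 * k) - 1)) / 3⌋ = k := by
      rw [Int.floor_eq_iff]
      split_ifs <;> constructor <;> linarith
    simp only [hf]
    split_ifs <;> linarith
  right_inv x := by
    beta_reduce
    have h1 := Int.floor_le (x / 3)
    have h2 := Int.lt_floor_add_one (x / 3)
    generalize ⌊x / 3⌋ = k at *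
    have hf : ⌊(2 * (k : ℚ) + (if x - 3 * k ≤ 1 then x - 3 * k else ((x - 3 * k) + 1) / 2)) / 2⌋ = k := by
      rw [Int.floor_eq_iff]
      split_ifs <;> constructor <;> linarith
    simp only [hf]
    split_ifs <;> linarith

theorem trT_rel : trT * trA ^ 2 * trT⁻¹ = trA ^ 3 := by
  rw [mul_inv_eq_iff_eq_mul]
  ext x
  have e : ⌊(x + 1 + 1) / 2⌋ = ⌊x / 2⌋ + 1 := by
    rw [← Int.floor_add_one]; congr 1; ring
  simp only [pow_succ, pow_zero, one_mul, Equiv.Perm.mul_apply, trA, Equiv.coe_addRight, trT,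
    Equiv.coe_fn_mk, e]
  push_cast
  have e2 : x + 1 + 1 - 2 * ((⌊x / 2⌋ : ℚ) + 1) = x - 2 * ⌊x / 2⌋ := by ring
  rw [e2]
  ring

theorem trT_not : (trA * (trT * trA * trT⁻¹))⁻¹ * ((trT * trA * trT⁻¹) * trA) ≠ 1 := by
  intro h
  rw [inv_mul_eq_one] at h
  have t0 : trT 0 = 0 := by simp [trT]
  have t1 : trT 1 = 1 := by
    have : ⌊(1 : ℚ) / 2⌋ = 0 := by rw [Int.floor_eq_iff]; norm_num
    simp only [trT, Equiv.coe_fn_mk, this]; norm_num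
  have t2 : trT 2 = 3 := by simp [trT]
  have h0 : trT⁻¹ 0 = 0 := by rw [Equiv.Perm.inv_eq_iff_eq, t0]
  have h1 : trT⁻¹ 1 = 1 := by rw [Equiv.Perm.inv_eq_iff_eq, t1]
  have a0 : trA 0 = 1 := by simp [trA]
  have a1 : trA 1 = 2 := by simp [trA]; norm_num
  have := congrArg (fun p : Equiv.Perm ℚ => p 0) h
  simp only [Equiv.Perm.mul_apply, a0, h0, h1, a1, t1, t2] at this
  norm_num at this

theorem not_lerf_of_free {G L₁ L₂ : Type*} [Group G] [Group L₁] [Group L₂] {A B C D : G}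
    (hAB : Commute A B) (hBC : Commute B C) (hCD : Commute C D)
    (φ : G →* L₁) (ψ : G →* L₂) (φB : φ B = 1) (φD : φ D = 1) (ψA : ψ A = 1) (ψC : ψ C = 1)
    (hφ : Function.Injective (FreeGroup.lift ![φ A, φ C]))
    (hψ : Function.Injective (FreeGroup.lift ![ψ B, ψ D])) : ¬ SubgroupSeparable G := by
  classical
  intro hG
  rw [lerf_iff] at hG
  let T : Finset G := {C * B⁻¹, A * (C ^ 2 * (B ^ 3)⁻¹) * A⁻¹, D⁻¹ * A⁻¹}
  let g : G := (C * (A * C * A⁻¹))⁻¹ * ((A * C * A⁻¹) * C)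
  have hg : g ∉ Subgroup.closure (T : Set G) := by
    intro hmem
    have key : ∀ x ∈ Subgroup.closure (T : Set G), ∃ u v : FreeGroup (Fin 2),
        φ x = FreeGroup.lift ![φ A, φ C] u ∧ ψ x = FreeGroup.lift ![ψ B, ψ D] v ∧
        FreeGroup.lift ![trT, trA] u = FreeGroup.lift ![trA⁻¹, trT] v := by
      intro x hx
      induction hx using Subgroup.closure_induction with
      | mem x hx =>
        simp only [T, Finset.coe_insert, Finset.coe_singleton] at hx
        rcases hx with rfl | rfl | rfl
        · exact ⟨FreeGroup.of 1, (FreeGroup.of 0)⁻¹, by simp [φB], by simp [ψC], by simp⟩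
        · refine ⟨FreeGroup.of 0 * FreeGroup.of 1 ^ 2 * (FreeGroup.of 0)⁻¹,
            ((FreeGroup.of 0) ^ 3)⁻¹, by simp [φB], by simp [ψC, ψA], ?_⟩
          simpa using trT_rel
        · exact ⟨(FreeGroup.of 0)⁻¹, (FreeGroup.of 1)⁻¹, by simp [φD], by simp [ψA], by simp⟩
      | one => exact ⟨1, 1, by simp, by simp, by simp⟩
      | mul x y _ _ h1 h2 =>
        obtain ⟨u, v, k1, k2, k3⟩ := h1
        obtain ⟨u', v', k1', k2', k3'⟩ := h2
        exact ⟨u * u', v * v', by rw [map_mul, map_mul, k1, k1'], by rw [map_mul, map_mul, k2, k2'],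
          by rw [map_mul, map_mul, k3, k3']⟩
      | inv x _ h1 =>
        obtain ⟨u, v, k1, k2, k3⟩ := h1
        exact ⟨u⁻¹, v⁻¹, by rw [map_inv, map_inv, k1], by rw [map_inv, map_inv, k2],
          by rw [map_inv, map_inv, k3]⟩
    obtain ⟨u, v, h1, h2, h3⟩ := key g hmem
    have hv : v = 1 := by
      apply hψ
      rw [← h2]
      simp [g, ψA, ψC]
    let F0 : FreeGroup (Fin 2) := FreeGroup.of 0
    let F1 : FreeGroup (Fin 2) := FreeGroup.of 1
    have hu : u = (F1 * (F0 * F1 * F0⁻¹))⁻¹ * ((F0 * F1 * F0⁻¹) * F1) := by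
      apply hφ
      rw [← h1]
      simp [g, F0, F1]
    rw [hu, hv, map_one] at h3
    apply trT_not
    rw [← h3]
    simp [F0, F1]
  obtain ⟨K, hK, hTK, hgK⟩ := hG _ ⟨T, rfl⟩ g hg
  apply hgK
  let x₀ : G ⧸ K := QuotientGroup.mk 1
  have hx : ∀ k : G, k • x₀ = x₀ ↔ k ∈ K := by
    intro k
    have h1 : k • x₀ = QuotientGroup.mk (k * 1) := rfl
    rw [h1, eq_comm, QuotientGroup.eq]; simp
  have hT : ∀ t ∈ T, t • x₀ = x₀ := fun t ht => (hx t).2 (hTK (Subgroup.subset_closure ht))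
  rw [← hx]
  have e1 := hT (C * B⁻¹) (by simp [T])
  have e2 := hT (A * (C ^ 2 * (B ^ 3)⁻¹) * A⁻¹) (by simp [T])
  have e3 := hT (D⁻¹ * A⁻¹) (by simp [T])
  refine loop_fix hAB hBC hCD x₀ (A⁻¹ • x₀) (by simp) ?_ ?_ ?_ ?_
  · rw [mul_smul, inv_smul_eq_iff] at e3
    exact e3.symm
  · rw [hBC.symm.inv_right.eq, mul_smul, inv_smul_eq_iff] at e1
    exact e1
  · rw [mul_smul, mul_smul, ← eq_inv_smul_iff, ((hBC.symm.pow_pow 2 3).inv_right).eq, mul_smul,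
      inv_smul_eq_iff] at e2
    exact e2
  · obtain ⟨n, h1, _, h2⟩ := Subgroup.exists_pow_mem_of_index_ne_zero hK.index_ne_zero B
    exact ⟨n, h1, (hx _).2 h2⟩


/-! ### Ping-pong for unipotent pairs -/

open scoped Pointwise in
theorem pingpong {L X : Type*} [Group L] [MulAction L X] (e : ℂ × ℂ → X)
    (he : Function.Injective e) (P Q : L) (α β : ℂ) (hα : 2 ≤ ‖α‖) (hβ : 2 ≤ ‖β‖)
    (hP : ∀ x y, P • e (x, y) = e (x + α * y, y))
    (hQ : ∀ x y, Q • e (x, y) = e (x, y + β * x)) :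
    Function.Injective (FreeGroup.lift ![P, Q]) := by
  have hPn : ∀ (n : ℤ) x y, P ^ n • e (x, y) = e (x + n * α * y, y) := by
    intro n
    induction n using Int.induction_on with
    | zero => intro x y; simp
    | succ n ih =>
      intro x y
      rw [zpow_add_one, mul_smul, hP, ih]
      push_cast
      ring_nf
    | pred n ih =>
      intro x y
      rw [zpow_sub_one, mul_smul]
      have : P⁻¹ • e (x, y) = e (x - α * y, y) := by
        rw [inv_smul_eq_iff, hP]
        ring_nf
      rw [this, ih]
      push_cast
      ring_nf
  have hQn : ∀ (n : ℤ) x y, Q ^ n • e (x, y) = e (x, y + n * β * x) := by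
    intro n
    induction n using Int.induction_on with
    | zero => intro x y; simp
    | succ n ih =>
      intro x y
      rw [zpow_add_one, mul_smul, hQ, ih]
      push_cast
      ring_nf
    | pred n ih =>
      intro x y
      rw [zpow_sub_one, mul_smul]
      have : Q⁻¹ • e (x, y) = e (x, y - β * x) := by
        rw [inv_smul_eq_iff, hQ]
        ring_nf
      rw [this, ih]
      push_cast
      ring_nf
  have key : ∀ (n : ℤ) (γ x y : ℂ), n ≠ 0 → 2 ≤ ‖γ‖ → ‖x‖ < ‖y‖ → ‖y‖ < ‖x + n * γ * y‖ := by
    intro n γ x y hn hγ hxy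
    have h1 : ‖(n : ℂ) * γ * y‖ = ‖(n : ℂ)‖ * ‖γ‖ * ‖y‖ := by rw [norm_mul, norm_mul]
    have h2 : (1 : ℝ) ≤ ‖(n : ℂ)‖ := by
      rw [Complex.norm_intCast]
      exact_mod_cast Int.one_le_abs hn
    have h3 : ‖(n : ℂ) * γ * y‖ ≤ ‖x + n * γ * y‖ + ‖x‖ := by
      calc ‖(n : ℂ) * γ * y‖ = ‖(x + n * γ * y) - x‖ := by ring_nf
        _ ≤ _ := norm_sub_le _ _
    have h4 : 2 ≤ ‖(n : ℂ)‖ * ‖γ‖ := by nlinarith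
    have h5 : 0 ≤ ‖x‖ := norm_nonneg x
    nlinarith [norm_nonneg y]
  set a : Fin 2 → L := ![P, Q] with ha
  let S : Fin 2 → Set X := fun i => if i = 0 then e '' {p | ‖p.2‖ < ‖p.1‖} else
    e '' {p | ‖p.1‖ < ‖p.2‖}
  have hS0 : S 0 = e '' {p | ‖p.2‖ < ‖p.1‖} := rfl
  have hS1 : S 1 = e '' {p | ‖p.1‖ < ‖p.2‖} := rfl
  have hdis : Disjoint (S 0) (S 1) := by
    rw [hS0, hS1, Set.disjoint_image_iff he, Set.disjoint_left]
    intro p h1 h2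
    exact lt_asymm (show ‖p.2‖ < ‖p.1‖ from h1) h2
  have hcomp : FreeGroup.lift a =
      (Monoid.CoprodI.lift fun i => FreeGroup.lift fun _ => a i).comp
        (@freeGroupEquivCoprodI (Fin 2)).toMonoidHom := by
    ext i
    simp
  rw [hcomp, MonoidHom.coe_comp]
  refine Function.Injective.comp ?_ (MulEquiv.injective freeGroupEquivCoprodI)
  refine Monoid.CoprodI.lift_injective_of_ping_pong
    (H := fun _ : Fin 2 => FreeGroup Unit) (fun i => FreeGroup.lift fun _ => a i) ?_ S ?_ ?_ ?_
  · right
    refine ⟨0, ?_⟩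
    rw [FreeGroup.freeGroupUnitEquivInt.cardinal_eq, Cardinal.mk_denumerable]
    exact Cardinal.natCast_le_aleph0
  · intro i
    fin_cases i
    · exact ⟨e (1, 0), (1, 0), by simp, rfl⟩
    · exact ⟨e (0, 1), (0, 1), by simp, rfl⟩
  · intro i j hij
    fin_cases i <;> fin_cases j
    · exact absurd rfl hij
    · exact hdis
    · exact hdis.symm
    · exact absurd rfl hij
  · intro i j hij
    refine FreeGroup.freeGroupUnitEquivInt.forall_congr_left.mpr ?_
    intro n hne1
    have hn : n ≠ 0 := by
      rintro rfl
      apply hne1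
      simp [FreeGroup.freeGroupUnitEquivInt]
    change FreeGroup.lift (fun _ => a i) (FreeGroup.of () ^ n) • S j ⊆ S i
    rw [map_zpow, FreeGroup.lift_apply_of]
    fin_cases i <;> fin_cases j
    · exact absurd rfl hij
    · change P ^ n • S 1 ⊆ S 0
      rintro _ ⟨_, ⟨⟨x, y⟩, hxy, rfl⟩, rfl⟩
      refine ⟨(x + n * α * y, y), key n α x y hn hα hxy, (hPn n x y).symm⟩
    · change Q ^ n • S 0 ⊆ S 1
      rintro _ ⟨_, ⟨⟨x, y⟩, hxy, rfl⟩, rfl⟩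
      refine ⟨(x, y + n * β * x), key n β y x hn hβ hxy, (hQn n x y).symm⟩
    · exact absurd rfl hij


/-! ### Quadratic algebra: powers of a product of two reflections -/

theorem sin_step (φ : ℂ) (k : ℂ) :
    Complex.sin ((k + 1 + 1) * φ) = 2 * Complex.cos φ * Complex.sin ((k + 1) * φ)
      - Complex.sin (k * φ) := by
  have h1 : (k + 1 + 1) * φ = (k + 1) * φ + φ := by ring
  have h2 : k * φ = (k + 1) * φ - φ := by ring
  rw [h1, h2, Complex.sin_add, Complex.sin_sub]
  ring

/-- coefficient of `X` in the power formula below -/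
noncomputable def xcoef (q φ : ℂ) : ℕ → ℂ
  | 0 => 0
  | k + 1 => xcoef q φ k + q ^ k * Complex.sin ((k + 1) * φ)

/-- powers of `M` when `M ^ 2 = 2 q cos φ M - q ^ 2 + X`, `M X = X`. -/
theorem pow_formula {R : Type*} [Ring R] [Algebra ℂ R] (q φ : ℂ) (M X : R)
    (h2 : M * M = (2 * q * Complex.cos φ) • M - (q ^ 2) • (1 : R) + X) (hX : M * X = X) (k : ℕ) :
    Complex.sin φ • M ^ (k + 1) = (q ^ k * Complex.sin ((k + 1) * φ)) • M
        - (q ^ (k + 1) * Complex.sin (k * φ)) • (1 : R) + (xcoef q φ k) • X := by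
  induction k with
  | zero => simp [xcoef]
  | succ k ih =>
    rw [pow_succ' M (k + 1), ← mul_smul_comm, ih, mul_add, mul_sub, mul_smul_comm, mul_smul_comm,
      mul_smul_comm, h2, hX, mul_one]
    have h := sin_step φ k
    push_cast
    rw [h]
    simp only [xcoef]
    module

theorem sin_two_pi_div_ne (n : ℕ) (hn : 3 ≤ n) : Complex.sin (2 * Real.pi / n) ≠ 0 := by
  have hn' : (3 : ℝ) ≤ n := by exact_mod_cast hn
  have h : 0 < Real.sin (2 * Real.pi / n) := by
    apply Real.sin_pos_of_pos_of_lt_pi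
    · positivity
    · rw [div_lt_iff₀ (by linarith)]
      nlinarith [Real.pi_pos]
  have h2 : Complex.sin (2 * Real.pi / n) = ((Real.sin (2 * Real.pi / n) : ℝ) : ℂ) := by
    push_cast; rfl
  rw [h2]
  exact_mod_cast h.ne'

theorem pow_formula_end {R : Type*} [Ring R] [Algebra ℂ R] (q : ℂ) (n : ℕ) (hn : 3 ≤ n) (M X : R)
    (h2 : M * M = (2 * q * Complex.cos (2 * Real.pi / n)) • M - (q ^ 2) • (1 : R) + X)
    (hX : M * X = X) :
    M ^ n = (q ^ n) • (1 : R) +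
      (xcoef q (2 * Real.pi / n) (n - 1) / Complex.sin (2 * Real.pi / n)) • X := by
  obtain ⟨k, rfl⟩ : ∃ k, n = k + 1 := ⟨n - 1, by omega⟩
  have hs := sin_two_pi_div_ne (k + 1) hn
  have h := pow_formula q (2 * Real.pi / (k + 1 : ℕ)) M X h2 hX k
  have hk : ((k : ℂ) + 1) ≠ 0 := by exact_mod_cast Nat.succ_ne_zero k
  have e1 : Complex.sin (((k : ℂ) + 1) * (2 * Real.pi / (k + 1 : ℕ))) = 0 := by
    have : ((k : ℂ) + 1) * (2 * Real.pi / (k + 1 : ℕ)) = 2 * Real.pi := by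
      push_cast; field_simp
    rw [this, Complex.sin_two_pi]
  have e2 : Complex.sin ((k : ℂ) * (2 * Real.pi / (k + 1 : ℕ))) =
      - Complex.sin (2 * Real.pi / (k + 1 : ℕ)) := by
    have : (k : ℂ) * (2 * Real.pi / (k + 1 : ℕ)) = 2 * Real.pi - 2 * Real.pi / (k + 1 : ℕ) := by
      push_cast; field_simp; ring
    rw [this, Complex.sin_two_pi_sub]
  rw [e1, e2] at h
  have h3 : M ^ (k + 1) = (Complex.sin (2 * Real.pi / (k + 1 : ℕ)))⁻¹ •
      (Complex.sin (2 * Real.pi / (k + 1 : ℕ)) • M ^ (k + 1)) := by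
    rw [smul_smul, inv_mul_cancel₀ hs, one_smul]
  rw [h3, h]
  simp only [Nat.add_sub_cancel]
  generalize Complex.sin (2 * Real.pi / (k + 1 : ℕ)) = w at hs
  match_scalars <;> field_simp <;> simp

section refl
variable {R : Type*} [Ring R] [Algebra ℂ R]

/-- relations between two rank-one operators of reflections -/
structure ReflPair (q t : ℂ) (E F : R) : Prop where
  ee : E * E = (1 + q) • E
  ff : F * F = (1 + q) • F
  efe : E * (F * E) = (t + 2 * q) • E
  fef : F * (E * F) = (t + 2 * q) • F

/-- the symmetric element attached to a pair -/
def reflX (q t : ℂ) (E F : R) : R :=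
  (1 - t + q ^ 2) • (1 : R) - (1 + q) • (E + F) + E * F + F * E

theorem ReflPair.symm {q t : ℂ} {E F : R} (h : ReflPair q t E F) : ReflPair q t F E :=
  ⟨h.ff, h.ee, h.fef, h.efe⟩

theorem reflX_symm (q t : ℂ) (E F : R) : reflX q t E F = reflX q t F E := by
  simp only [reflX]; module

theorem ReflPair.ee' {q t : ℂ} {E F : R} (h : ReflPair q t E F) (z : R) :
    E * (E * z) = (1 + q) • (E * z) := by rw [← mul_assoc, h.ee, smul_mul_assoc]

theorem ReflPair.efe' {q t : ℂ} {E F : R} (h : ReflPair q t E F) (z : R) :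
    E * (F * (E * z)) = (t + 2 * q) • (E * z) := by
  rw [← smul_mul_assoc, ← h.efe]; simp only [mul_assoc]

theorem ReflPair.sq {q t : ℂ} {E F : R} (h : ReflPair q t E F) :
    ((1 - E) * (1 - F)) * ((1 - E) * (1 - F)) =
      t • ((1 - E) * (1 - F)) - (q ^ 2) • (1 : R) + reflX q t E F := by
  simp only [reflX, mul_sub, sub_mul, mul_add, add_mul, one_mul, mul_one, mul_assoc,
    mul_smul_comm, smul_mul_assoc, h.ee, h.ff, h.efe, h.fef, h.ee', h.efe', h.symm.ee',
    h.symm.efe']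
  module

theorem ReflPair.Emul {q t : ℂ} {E F : R} (h : ReflPair q t E F) : E * reflX q t E F = 0 := by
  simp only [reflX, mul_sub, sub_mul, mul_add, add_mul, one_mul, mul_one, mul_assoc,
    mul_smul_comm, smul_mul_assoc, h.ee, h.ff, h.efe, h.fef, h.ee', h.efe', h.symm.ee',
    h.symm.efe']
  module

theorem ReflPair.mulE {q t : ℂ} {E F : R} (h : ReflPair q t E F) : reflX q t E F * E = 0 := by
  simp only [reflX, mul_sub, sub_mul, mul_add, add_mul, one_mul, mul_one, mul_assoc,
    mul_smul_comm, smul_mul_assoc, h.ee, h.ff, h.efe, h.fef, h.ee', h.efe', h.symm.ee',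
    h.symm.efe']
  module

theorem ReflPair.mulX {q t : ℂ} {E F : R} (h : ReflPair q t E F) :
    ((1 - E) * (1 - F)) * reflX q t E F = reflX q t E F := by
  have h2 := h.symm.Emul
  rw [reflX_symm] at h2
  rw [mul_assoc, sub_mul 1 F, h2, one_mul, sub_zero, sub_mul, h.Emul, one_mul, sub_zero]

theorem ReflPair.X_sq {q t : ℂ} {E F : R} (h : ReflPair q t E F) :
    reflX q t E F * reflX q t E F = (1 - t + q ^ 2) • reflX q t E F := by
  have h2 := h.symm.Emul
  rw [reflX_symm] at h2
  nth_rw 1 [reflX]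
  simp only [sub_mul, add_mul, smul_mul_assoc, one_mul, mul_assoc, h2, h.Emul, mul_zero]
  simp

theorem ReflPair.braid {q : ℂ} {E F : R} {m : ℕ} (hm : 3 ≤ m)
    (h : ReflPair q (2 * q * Complex.cos (2 * Real.pi / m)) E F) :
    altProd (1 - E) (1 - F) m = altProd (1 - F) (1 - E) m := by
  set φ : ℂ := 2 * Real.pi / m with hφ
  have hs := sin_two_pi_div_ne m hm
  have hm0 : (m : ℂ) ≠ 0 := by
    have : m ≠ 0 := by omega
    exact_mod_cast this
  rw [← hφ] at hs
  have fM := fun k => pow_formula q φ _ _ h.sq h.mulX k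
  have hsq2 := h.symm.sq
  have hmul2 := h.symm.mulX
  rw [reflX_symm q _ F E] at hsq2 hmul2
  have fN := fun k => pow_formula q φ _ _ hsq2 hmul2 k
  have hcancel : ∀ a b : R, Complex.sin φ • a = Complex.sin φ • b → a = b := by
    intro a b hab
    have := congrArg (fun z => (Complex.sin φ)⁻¹ • z) hab
    simpa only [smul_smul, inv_mul_cancel₀ hs, one_smul] using this
  rcases Nat.even_or_odd' m with ⟨k, hk | hk⟩
  · obtain ⟨j, rfl⟩ : ∃ j, k = j + 1 := ⟨k - 1, by omega⟩
    have e1 : Complex.sin (((j : ℂ) + 1) * φ) = 0 := by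
      have : ((j : ℂ) + 1) * φ = Real.pi := by
        rw [hφ]
        field_simp
        rw [hk]; push_cast; ring
      rw [this, Complex.sin_pi]
    rw [hk, altProd_even, altProd_even]
    apply hcancel
    rw [fM, fN, e1]
    simp
  · obtain ⟨j, rfl⟩ : ∃ j, k = j + 1 := ⟨k - 1, by omega⟩
    have e1 : Complex.sin ((j : ℂ) * φ) = 
        Complex.sin (((j : ℂ) + 1) * φ) * (2 * Complex.cos φ + 1) := by
      have a1 : ((j : ℂ) + 1) * φ = Real.pi - φ / 2 := by
        rw [hφ]
        field_simp
        rw [hk]; push_cast; ring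
      have a2 : (j : ℂ) * φ = Real.pi - 3 * (φ / 2) := by
        linear_combination a1
      have a3 : Complex.cos φ = 2 * Complex.cos (φ / 2) ^ 2 - 1 := by
        rw [← Complex.cos_two_mul]; ring_nf
      rw [a1, a2, Complex.sin_pi_sub, Complex.sin_pi_sub, Complex.sin_three_mul, a3,
        Complex.cos_sq']
      ring
    rw [hk, altProd_odd, altProd_odd]
    apply hcancel
    rw [← smul_mul_assoc, ← smul_mul_assoc, fM, fN, e1]
    have g1 : reflX q (2 * q * Complex.cos φ) E F * (1 - E) = reflX q (2 * q * Complex.cos φ) E F := by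
      rw [mul_sub, h.mulE, mul_one, sub_zero]
    have g2 : reflX q (2 * q * Complex.cos φ) E F * (1 - F) = reflX q (2 * q * Complex.cos φ) E F := by
      have := h.symm.mulE
      rw [reflX_symm] at this
      rw [mul_sub, this, mul_one, sub_zero]
    simp only [add_mul _ _ (1 - E), add_mul _ _ (1 - F), smul_mul_assoc, g1, g2]
    simp only [mul_sub, sub_mul, mul_add, add_mul, one_mul, mul_one, mul_assoc,
      mul_smul_comm, smul_mul_assoc, h.ee, h.ff, h.efe, h.fef, h.ee', h.efe', h.symm.ee',
      h.symm.efe']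
    module

end refl


/-! ### More on pairs of reflections -/

theorem pow_end_scalar (q : ℂ) (n : ℕ) (hn : 3 ≤ n) :
    1 = q ^ n + (xcoef q (2 * Real.pi / n) (n - 1) / Complex.sin (2 * Real.pi / n)) *
      (1 - 2 * q * Complex.cos (2 * Real.pi / n) + q ^ 2) := by
  have h := pow_formula_end (R := ℂ) q n hn 1
    (1 - 2 * q * Complex.cos (2 * Real.pi / n) + q ^ 2) (by simp) (by simp)
  simpa using h

theorem xcoef_closed (φ : ℂ) (k : ℕ) :
    2 * Complex.I * Complex.exp (Complex.I * φ) * (Complex.exp (Complex.I * φ) ^ 2 - 1) *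
      xcoef (Complex.exp (Complex.I * φ)) φ k =
    Complex.exp (Complex.I * φ) ^ 2 * (Complex.exp (Complex.I * φ) ^ (2 * k) - 1)
      - k * (Complex.exp (Complex.I * φ) ^ 2 - 1) := by
  set q := Complex.exp (Complex.I * φ) with hq
  have hq0 : q ≠ 0 := Complex.exp_ne_zero _
  induction k with
  | zero => simp [xcoef]
  | succ k ih =>
    have h1 : 2 * Complex.I * q ^ (k + 1) * Complex.sin ((k + 1) * φ) = q ^ (2 * k + 2) - 1 := by
      have e1 : Complex.exp ((k + 1) * φ * Complex.I) = q ^ (k + 1) := by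
        rw [hq, ← Complex.exp_nat_mul]; push_cast; ring_nf
      have e2 : Complex.exp (-((k + 1) * φ) * Complex.I) = (q ^ (k + 1))⁻¹ := by
        rw [neg_mul, Complex.exp_neg, e1]
      rw [Complex.sin, e1, e2]
      have hI := Complex.I_sq
      field_simp
      linear_combination (q ^ (2 * k + 2) - 1) * (-1) * hI
    simp only [xcoef]
    push_cast
    linear_combination ih + (q ^ 2 - 1) * h1

theorem xcoef_ne (m : ℕ) (hm : 3 ≤ m) :
    xcoef (Complex.exp (Complex.I * (2 * Real.pi / m))) (2 * Real.pi / m) (m - 1) ≠ 0 := by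
  intro h0
  have h := xcoef_closed (2 * Real.pi / m) (m - 1)
  have hprim : IsPrimitiveRoot (Complex.exp (Complex.I * (2 * Real.pi / m))) m := by
    have := Complex.isPrimitiveRoot_exp m (by omega)
    convert this using 2
    ring
  set q := Complex.exp (Complex.I * (2 * Real.pi / m)) with hq
  have hq2 : q ^ 2 ≠ 1 := hprim.pow_ne_one_of_pos_of_lt (by omega) (by omega)
  rw [h0, mul_zero] at h
  have e : q ^ 2 * q ^ (2 * (m - 1)) = 1 := by
    rw [← pow_add, show 2 + 2 * (m - 1) = m * 2 by omega, pow_mul, hprim.pow_eq_one, one_pow]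
  have hc : ((m - 1 : ℕ) : ℂ) = m - 1 := by
    rw [Nat.cast_sub (by omega)]; simp
  rw [hc] at h
  have : (m : ℂ) * (q ^ 2 - 1) = 0 := by linear_combination h + e
  rcases mul_eq_zero.mp this with h1 | h1
  · have : m = 0 := by exact_mod_cast h1
    omega
  · exact hq2 (sub_eq_zero.mp h1)

section refl2
variable {R : Type*} [Ring R] [Algebra ℂ R]

theorem ReflPair.pow_m {q : ℂ} {E F : R} {m : ℕ} (hm : 3 ≤ m)
    (h : ReflPair q (2 * q * Complex.cos (2 * Real.pi / m)) E F) :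
    ((1 - E) * (1 - F)) ^ m = (q ^ m) • (1 : R) +
      (xcoef q (2 * Real.pi / m) (m - 1) / Complex.sin (2 * Real.pi / m)) •
        reflX q (2 * q * Complex.cos (2 * Real.pi / m)) E F :=
  pow_formula_end q m hm _ _ h.sq h.mulX

theorem ReflPair.pow_two_m {E F : R} {m : ℕ} (hm : 3 ≤ m)
    (h : ReflPair (-1) (2 * (-1) * Complex.cos (2 * Real.pi / m)) E F) :
    ((1 - E) * (1 - F)) ^ (2 * m) = 1 := by
  have h1 := h.pow_m hm
  have h2 := pow_end_scalar (-1) m hm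
  have hX := h.X_sq
  have hc : (1 - 2 * (-1) * Complex.cos (2 * Real.pi / m) + (-1) ^ 2 : ℂ) ≠ 0 := by
    intro h0
    have hcos : Complex.cos (2 * Real.pi / m) = -1 := by linear_combination h0 / 2
    have hs := Complex.sin_sq_add_cos_sq (2 * Real.pi / m)
    rw [hcos] at hs
    have : Complex.sin (2 * Real.pi / m) ^ 2 = 0 := by linear_combination hs
    exact sin_two_pi_div_ne m hm (pow_eq_zero_iff (two_ne_zero) |>.mp this)
  set X := reflX (-1) (2 * (-1) * Complex.cos (2 * Real.pi / m)) E F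
  set δ : ℂ := 1 - 2 * (-1) * Complex.cos (2 * Real.pi / m) + (-1) ^ 2 with hδ
  set x := xcoef (-1) (2 * Real.pi / m) (m - 1) / Complex.sin (2 * Real.pi / m)
  rw [mul_comm 2 m, pow_mul, h1, pow_two]
  simp only [mul_add, add_mul, mul_smul_comm, smul_mul_assoc, one_mul, mul_one, hX]
  rcases neg_one_pow_eq_or ℂ m with hp | hp
  · rw [hp] at h2 ⊢
    have hx : x = 0 := by
      have : x * δ = 0 := by linear_combination -h2
      exact (mul_eq_zero.mp this).resolve_right hc
    rw [hx]; simp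
  · rw [hp] at h2 ⊢
    have : x * δ = 2 := by linear_combination -h2
    rw [smul_smul x δ X, this]
    module

theorem one_sub_pow {q : ℂ} {E : R} (h : E * E = (1 + q) • E) (hq : 1 + q ≠ 0) (k : ℕ) :
    (1 - E) ^ k = 1 - ((1 - (-q) ^ k) / (1 + q)) • E := by
  induction k with
  | zero => simp
  | succ k ih =>
    rw [pow_succ, ih]
    simp only [mul_sub, sub_mul, one_mul, mul_one, smul_mul_assoc, h]
    match_scalars
    · ring
    · field_simp
      ring

end refl2

theorem central_of_braid {G : Type*} [Group G] {a b : G} {m : ℕ}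
    (h : altProd a b m = altProd b a m) :
    Commute ((a * b) ^ m) a ∧ Commute ((a * b) ^ m) b := by
  rcases Nat.even_or_odd' m with ⟨k, hk | hk⟩
  · rw [hk, altProd_even, altProd_even] at h
    have e : ∀ (u v : G) (k : ℕ), u * (v * u) ^ k = (u * v) ^ k * u := by
      intro u v k
      exact (SemiconjBy.pow_right (a := u) (x := v * u) (y := u * v) (by
        simp [SemiconjBy, mul_assoc]) k).eq
    have c1 : Commute ((a * b) ^ k) a := by
      change _ * _ = _ * _
      rw [← e, h]
    have c2 : Commute ((a * b) ^ k) b := by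
      change _ * _ = _ * _
      rw [e, ← h]
    rw [hk, mul_comm 2 k, pow_mul]
    exact ⟨c1.pow_left 2, c2.pow_left 2⟩
  · rw [hk, altProd_odd, altProd_odd] at h
    have e : ∀ (u v : G) (k : ℕ), u * (v * u) ^ k = (u * v) ^ k * u := by
      intro u v k
      exact (SemiconjBy.pow_right (a := u) (x := v * u) (y := u * v) (by
        simp [SemiconjBy, mul_assoc]) k).eq
    set D := (a * b) ^ k * a with hD
    have d1 : a * D = D * b := by
      rw [h, ← mul_assoc, e, ← hD, h]
    have d2 : b * D = D * a := by
      conv_lhs => rw [hD, ← mul_assoc, e, ← h]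
    have d3 : (a * b) ^ m = D * D := by
      have : D * D = (a * b) ^ k * a * ((b * a) ^ k * b) := by rw [← h]
      rw [this, hk, show 2 * k + 1 = k + (k + 1) by ring, pow_add, pow_succ (a * b) k]
      simp only [mul_assoc]
      rw [← mul_assoc a ((b * a) ^ k) b, e]
      simp only [mul_assoc]
    rw [d3]
    constructor
    · change _ * _ = _ * _
      rw [mul_assoc, ← d2, ← mul_assoc, ← d1, mul_assoc]
    · change _ * _ = _ * _
      rw [mul_assoc, ← d1, ← mul_assoc, ← d2, mul_assoc]

/-! ### Reflection representations -/

section rep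
variable {W : Type*} [AddCommGroup W] [Module ℂ W]

/-- rank one operator -/
def rk1 (h : W →ₗ[ℂ] ℂ) (e : W) : Module.End ℂ W := h.smulRight e

theorem rk1_apply (h : W →ₗ[ℂ] ℂ) (e x : W) : rk1 h e x = h x • e := rfl

theorem rk1_mul (h h' : W →ₗ[ℂ] ℂ) (e e' : W) : rk1 h e * rk1 h' e' = h e' • rk1 h' e := by
  ext x
  simp [rk1_apply, smul_smul, mul_comm]

theorem rk1_pair {q t : ℂ} {h h' : W →ₗ[ℂ] ℂ} {e e' : W} (h1 : h e = 1 + q) (h2 : h' e' = 1 + q)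
    (h3 : h e' * h' e = t + 2 * q) : ReflPair q t (rk1 h e) (rk1 h' e') := by
  constructor
  · rw [rk1_mul, h1]
  · rw [rk1_mul, h2]
  · rw [rk1_mul, mul_smul_comm, rk1_mul, smul_smul, ← h3, mul_comm]
  · rw [rk1_mul, mul_smul_comm, rk1_mul, smul_smul, ← h3]

/-- a reflection as a unit -/
noncomputable def reflUnit (q : ℂ) (hq : q ≠ 0) (h : W →ₗ[ℂ] ℂ) (e : W) (h1 : h e = 1 + q) :
    (Module.End ℂ W)ˣ where
  val := 1 - rk1 h e
  inv := 1 - q⁻¹ • rk1 h e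
  val_inv := by
    simp only [mul_sub, sub_mul, one_mul, mul_one, mul_smul_comm, rk1_mul, h1]
    match_scalars
    · ring
    · field_simp; ring
  inv_val := by
    simp only [mul_sub, sub_mul, one_mul, mul_one, smul_mul_assoc, rk1_mul, h1]
    match_scalars
    · ring
    · field_simp; ring

variable {V : Type*}

/-- representation of an Artin group by reflections -/
noncomputable def reflRep (Γ : SimpleGraph V) (ℓ : V → V → ℕ) (q : ℂ) (hq : q ≠ 0)
    (h : V → W →ₗ[ℂ] ℂ) (e : V → W) (h1 : ∀ u, h u (e u) = 1 + q)
    (hbr : ∀ u v, Γ.Adj u v → altProd (1 - rk1 (h u) (e u)) (1 - rk1 (h v) (e v)) (ℓ u v) =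
      altProd (1 - rk1 (h v) (e v)) (1 - rk1 (h u) (e u)) (ℓ u v)) :
    ArtinGroup Γ ℓ →* (Module.End ℂ W)ˣ :=
  artinLift Γ ℓ (fun u => reflUnit q hq (h u) (e u) (h1 u)) (by
    intro u v huv
    apply Units.ext
    have := hbr u v huv
    have key := fun x y : (Module.End ℂ W)ˣ => map_altProd (Units.coeHom (Module.End ℂ W)) x y (ℓ u v)
    simp only [Units.coeHom_apply] at key
    rw [key, key]
    exact this)

theorem reflRep_val (Γ : SimpleGraph V) (ℓ : V → V → ℕ) (q : ℂ) (hq : q ≠ 0)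
    (h : V → W →ₗ[ℂ] ℂ) (e : V → W) (h1 : ∀ u, h u (e u) = 1 + q) (hbr) (u : V) :
    ((reflRep Γ ℓ q hq h e h1 hbr (aof Γ ℓ u) : (Module.End ℂ W)ˣ) : Module.End ℂ W) =
      1 - rk1 (h u) (e u) := by
  rw [reflRep, artinLift_aof]; rfl

theorem reflRep_inv (Γ : SimpleGraph V) (ℓ : V → V → ℕ) (q : ℂ) (hq : q ≠ 0)
    (h : V → W →ₗ[ℂ] ℂ) (e : V → W) (h1 : ∀ u, h u (e u) = 1 + q) (hbr) (u : V) :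
    (((reflRep Γ ℓ q hq h e h1 hbr (aof Γ ℓ u))⁻¹ : (Module.End ℂ W)ˣ) : Module.End ℂ W) =
      1 - q⁻¹ • rk1 (h u) (e u) := by
  rw [reflRep, artinLift_aof]; rfl

/-- braid relation for rank one reflections, general label -/
theorem rk1_braid {q : ℂ} {h h' : W →ₗ[ℂ] ℂ} {e e' : W} (h1 : h e = 1 + q) (h2 : h' e' = 1 + q)
    {m : ℕ} (hm : 3 ≤ m) (h3 : h e' * h' e = q * (2 * Real.cos (Real.pi / m)) ^ 2) :
    ReflPair q (2 * q * Complex.cos (2 * Real.pi / m)) (rk1 h e) (rk1 h' e') := by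
  apply rk1_pair h1 h2
  rw [h3]
  have : Complex.cos (2 * Real.pi / m) = 2 * Complex.cos (Real.pi / m) ^ 2 - 1 := by
    rw [← Complex.cos_two_mul]; ring_nf
  rw [this]
  push_cast
  ring

theorem rk1_comm {h h' : W →ₗ[ℂ] ℂ} {e e' : W} (h1 : h e' = 0) (h2 : h' e = 0) :
    altProd (1 - rk1 h e) (1 - rk1 h' e') 2 = altProd (1 - rk1 h' e') (1 - rk1 h e) 2 := by
  rw [altProd_two, altProd_two]
  simp only [mul_sub, sub_mul, one_mul, mul_one, rk1_mul, h1, h2]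
  module

end rep


section free
variable {W : Type*} [AddCommGroup W] [Module ℂ W]

theorem units_smul_eq (u : (Module.End ℂ W)ˣ) (x : W) : u • x = (u : Module.End ℂ W) x := rfl

theorem transvection_pow (h : W →ₗ[ℂ] ℂ) (r : W) (B : Module.End ℂ W) (β : ℂ)
    (hB : ∀ x, B x = x + (β * h x) • r) (hr : h r = 0) (K : ℕ) (x : W) :
    (B ^ K) x = x + (K * β * h x) • r := by
  induction K generalizing x with
  | zero => simp
  | succ K ih =>
    rw [pow_succ, Module.End.mul_apply, hB, ih]
    simp only [map_add, map_smul, hr]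
    push_cast
    match_scalars
    · ring
    · simp; ring

theorem transvection_free (h : W →ₗ[ℂ] ℂ) (r : W) (B y : (Module.End ℂ W)ˣ) (β : ℂ) (hβ : β ≠ 0)
    (hB : ∀ x, (B : Module.End ℂ W) x = x + (β * h x) • r) (hr : h r = 0)
    (hp : h ((y : Module.End ℂ W) r) ≠ 0)
    (hp' : h (((y⁻¹ : (Module.End ℂ W)ˣ) : Module.End ℂ W) r) ≠ 0) :
    ∃ K : ℕ, Function.Injective (FreeGroup.lift ![B ^ K, y * B ^ K * y⁻¹]) := by
  set p := h ((y : Module.End ℂ W) r) with hpd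
  set p' := h (((y⁻¹ : (Module.End ℂ W)ˣ) : Module.End ℂ W) r) with hpd'
  obtain ⟨K1, hK1⟩ := exists_nat_ge (2 / ‖β * p‖)
  obtain ⟨K2, hK2⟩ := exists_nat_ge (2 / ‖β * p'‖)
  have hr0 : r ≠ 0 := by
    rintro rfl
    simp at hpd
    exact hp hpd
  have hyr : (y : Module.End ℂ W) (((y⁻¹ : (Module.End ℂ W)ˣ) : Module.End ℂ W) r) = r := by
    rw [← Module.End.mul_apply, Units.mul_inv, Module.End.one_apply]
  have hyr' : (((y⁻¹ : (Module.End ℂ W)ˣ) : Module.End ℂ W)) ((y : Module.End ℂ W) r) = r := by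
    rw [← Module.End.mul_apply, Units.inv_mul, Module.End.one_apply]
  refine ⟨max K1 K2, ?_⟩
  set K := max K1 K2 with hKd
  have hBK : ∀ x, ((B ^ K : (Module.End ℂ W)ˣ) : Module.End ℂ W) x = x + (K * β * h x) • r := by
    intro x
    rw [Units.val_pow_eq_pow_val]
    exact transvection_pow h r _ β hB hr K x
  have hn : ∀ z : ℂ, z ≠ 0 → ∀ K' : ℕ, K' ≤ K → 2 / ‖β * z‖ ≤ K' → 2 ≤ ‖K * β * z‖ := by
    intro z hz K' hK' hle
    have hpos : 0 < ‖β * z‖ := norm_pos_iff.mpr (mul_ne_zero hβ hz)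
    rw [mul_assoc, norm_mul, Complex.norm_natCast]
    have h2 : 2 / ‖β * z‖ ≤ K := hle.trans (by exact_mod_cast hK')
    rwa [div_le_iff₀ hpos] at h2
  refine pingpong (fun p : ℂ × ℂ => p.1 • r + p.2 • (y : Module.End ℂ W) r) ?_ _ _
    (K * β * p) (K * β * p') (hn p hp K1 (le_max_left _ _) hK1) (hn p' hp' K2 (le_max_right _ _) hK2)
    ?_ ?_
  · rintro ⟨x, z⟩ ⟨x', z'⟩ hxz
    simp only at hxz
    have e1 := congrArg h hxz
    simp only [map_add, map_smul, hr, smul_eq_mul, mul_zero, zero_add] at e1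
    have hz : z = z' := mul_right_cancel₀ hp e1
    subst hz
    have e2 : x • r = x' • r := add_right_cancel hxz
    have hx : x = x' := smul_left_injective ℂ hr0 e2
    rw [hx]
  · intro x z
    simp only [units_smul_eq, hBK, map_add, map_smul, hr, ← hpd, smul_eq_mul]
    module
  · intro x z
    simp only [units_smul_eq, Units.val_mul, Module.End.mul_apply, map_add, map_smul, hyr', hBK, hr,
      ← hpd', smul_eq_mul, hyr]
    module

theorem unipotent_free (h h' : W →ₗ[ℂ] ℂ) (e e' : W) (P Q : (Module.End ℂ W)ˣ)
    (hP : (P : Module.End ℂ W) = 1 - rk1 h e) (hQ : (Q : Module.End ℂ W) = 1 - rk1 h' e')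
    (he : h e = 0) (he' : h' e' = 0) (h1 : 1 ≤ ‖h e'‖) (h2 : 1 ≤ ‖h' e‖) (k : ℕ) (hk : 2 ≤ k) :
    Function.Injective (FreeGroup.lift ![P ^ k, Q ^ k]) := by
  have hPk : ∀ x, ((P ^ k : (Module.End ℂ W)ˣ) : Module.End ℂ W) x = x + (k * (-1) * h x) • e := by
    intro x
    rw [Units.val_pow_eq_pow_val]
    refine transvection_pow h e _ (-1) (fun x => ?_) he k x
    rw [hP, LinearMap.sub_apply, rk1_apply, Module.End.one_apply]
    module
  have hQk : ∀ x, ((Q ^ k : (Module.End ℂ W)ˣ) : Module.End ℂ W) x = x + (k * (-1) * h' x) • e' := by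
    intro x
    rw [Units.val_pow_eq_pow_val]
    refine transvection_pow h' e' _ (-1) (fun x => ?_) he' k x
    rw [hQ, LinearMap.sub_apply, rk1_apply, Module.End.one_apply]
    module
  have hk' : (2 : ℝ) ≤ k := by exact_mod_cast hk
  have hn : ∀ z : ℂ, 1 ≤ ‖z‖ → 2 ≤ ‖(k * (-1) * z : ℂ)‖ := by
    intro z hz
    rw [norm_mul, norm_mul, norm_neg, norm_one, Complex.norm_natCast]
    nlinarith
  have g1 : h e' ≠ 0 := by intro h0; rw [h0] at h1; simp at h1; linarith
  have g2 : h' e ≠ 0 := by intro h0; rw [h0] at h2; simp at h2; linarith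
  refine pingpong (fun p : ℂ × ℂ => p.1 • e + p.2 • e') ?_ _ _
    (k * (-1) * h e') (k * (-1) * h' e) (hn _ h1) (hn _ h2) ?_ ?_
  · rintro ⟨x, z⟩ ⟨x', z'⟩ hxz
    simp only at hxz
    have e1 := congrArg h hxz
    have e2 := congrArg h' hxz
    simp only [map_add, map_smul, he, he', smul_eq_mul, mul_zero, zero_add, add_zero] at e1 e2
    rw [mul_right_cancel₀ g1 e1, mul_right_cancel₀ g2 e2]
  · intro x z
    simp only [units_smul_eq, hPk, map_add, map_smul, he, smul_eq_mul]
    module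
  · intro x z
    simp only [units_smul_eq, hQk, map_add, map_smul, he', smul_eq_mul]
    module

end free

theorem two_cos_ge_one (m : ℕ) (hm : 3 ≤ m) : 1 ≤ 2 * Real.cos (Real.pi / m) := by
  have hm' : (3 : ℝ) ≤ m := by exact_mod_cast hm
  have : Real.cos (Real.pi / 3) ≤ Real.cos (Real.pi / m) := by
    apply Real.cos_le_cos_of_nonneg_of_le_pi
    · positivity
    · linarith [Real.pi_pos]
    · gcongr
  rw [Real.cos_pi_div_three] at this
  linarith

theorem two_cos_lt_two (m : ℕ) (hm : 2 ≤ m) : 2 * Real.cos (Real.pi / m) < 2 := by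
  have hm' : (2 : ℝ) ≤ m := by exact_mod_cast hm
  have : Real.cos (Real.pi / m) < Real.cos 0 := by
    apply Real.cos_lt_cos_of_nonneg_of_le_pi
    · exact le_refl 0
    · rw [div_le_iff₀ (by linarith)]
      nlinarith [Real.pi_pos]
    · positivity
  rw [Real.cos_zero] at this
  linarith

theorem two_cos_two : 2 * Real.cos (Real.pi / (2 : ℕ)) = 0 := by
  simp

section triple
variable {V : Type*} [Fintype V] [DecidableEq V]

/-- the functional with prescribed values on basis vectors -/
def rowFun (f : V → V → ℂ) (u : V) : (V → ℂ) →ₗ[ℂ] ℂ := ∑ w, f u w • LinearMap.proj w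

theorem rowFun_single (f : V → V → ℂ) (u v : V) : rowFun f u (Pi.single v 1) = f u v := by
  simp [rowFun, Pi.single_apply]

/-- matrix of the generalized Burau representation -/
noncomputable def burau (q κ : ℂ) (s : V → V → ℝ) (u v : V) : ℂ :=
  if u = v then 1 + q else κ * s u v

theorem burau_self (q κ : ℂ) (s : V → V → ℝ) (u : V) : burau q κ s u u = 1 + q := by
  simp [burau]

theorem burau_ne (q κ : ℂ) (s : V → V → ℝ) {u v : V} (h : u ≠ v) : burau q κ s u v = κ * s u v := by
  simp [burau, h]

theorem burau_pair {Γ : SimpleGraph V} {ℓ : V → V → ℕ} (q κ : ℂ) (hκ : κ ^ 2 = q) (s : V → V → ℝ)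
    (hs : ∀ u v, Γ.Adj u v → s u v * s v u = (2 * Real.cos (Real.pi / ℓ u v)) ^ 2) {u v : V}
    (huv : Γ.Adj u v) (h3 : 3 ≤ ℓ u v) :
    ReflPair q (2 * q * Complex.cos (2 * Real.pi / ℓ u v))
      (rk1 (rowFun (burau q κ s) u) (Pi.single u 1))
      (rk1 (rowFun (burau q κ s) v) (Pi.single v 1)) := by
  apply rk1_braid
  · rw [rowFun_single, burau_self]
  · rw [rowFun_single, burau_self]
  · exact h3
  · rw [rowFun_single, rowFun_single, burau_ne _ _ _ huv.ne, burau_ne _ _ _ huv.ne.symm]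
    have := hs u v huv
    have h' : (s u v : ℂ) * s v u = (2 * (Real.cos (Real.pi / ℓ u v) : ℂ)) ^ 2 := by
      exact_mod_cast this
    rw [← h', ← hκ]
    ring

theorem burau_braid {Γ : SimpleGraph V} {ℓ : V → V → ℕ} (hge : ∀ u v, Γ.Adj u v → 2 ≤ ℓ u v)
    (q κ : ℂ) (hκ : κ ^ 2 = q) (s : V → V → ℝ)
    (hs : ∀ u v, Γ.Adj u v → s u v * s v u = (2 * Real.cos (Real.pi / ℓ u v)) ^ 2)
    (hs2 : ∀ u v, Γ.Adj u v → ℓ u v = 2 → s u v = 0 ∧ s v u = 0) (u v : V) (huv : Γ.Adj u v) :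
    altProd (1 - rk1 (rowFun (burau q κ s) u) (Pi.single u 1))
      (1 - rk1 (rowFun (burau q κ s) v) (Pi.single v 1)) (ℓ u v) =
    altProd (1 - rk1 (rowFun (burau q κ s) v) (Pi.single v 1))
      (1 - rk1 (rowFun (burau q κ s) u) (Pi.single u 1)) (ℓ u v) := by
  rcases (hge u v huv).eq_or_lt with h2 | h3
  · rw [← h2]
    obtain ⟨g1, g2⟩ := hs2 u v huv h2.symm
    apply rk1_comm
    · rw [rowFun_single, burau_ne _ _ _ huv.ne, g1]; simp
    · rw [rowFun_single, burau_ne _ _ _ huv.ne.symm, g2]; simp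
  · exact (burau_pair q κ hκ s hs huv h3).braid h3

end triple


section triple2
variable {V : Type*} [Fintype V] [DecidableEq V]

theorem rep_phi {Γ : SimpleGraph V} {ℓ : V → V → ℕ} (hsymm : ∀ u v, ℓ u v = ℓ v u)
    (hge : ∀ u v, Γ.Adj u v → 2 ≤ ℓ u v) {a b : V} (hab : Γ.Adj a b) (hm : 3 ≤ ℓ a b) :
    ∃ φ : ArtinGroup Γ ℓ →* (Module.End ℂ (V → ℂ))ˣ,
      φ ((aof Γ ℓ a * aof Γ ℓ b) ^ (2 * ℓ a b)) = 1 ∧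
      Function.Injective (FreeGroup.lift
        ![φ (aof Γ ℓ a ^ (4 * ℓ a b)), φ (aof Γ ℓ b ^ (4 * ℓ a b))]) := by
  let s : V → V → ℝ := fun u v => 2 * Real.cos (Real.pi / ℓ u v)
  have hs : ∀ u v, Γ.Adj u v → s u v * s v u = (2 * Real.cos (Real.pi / ℓ u v)) ^ 2 := by
    intro u v _
    simp only [s, hsymm v u]; ring
  have hs2 : ∀ u v, Γ.Adj u v → ℓ u v = 2 → s u v = 0 ∧ s v u = 0 := by
    intro u v _ h
    simp only [s, hsymm v u, h, two_cos_two, and_self]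
  let f := burau (-1) Complex.I s
  have h1 : ∀ u, rowFun f u (Pi.single u 1) = 1 + (-1) := fun u => by
    rw [rowFun_single]; exact burau_self ..
  let φ := reflRep Γ ℓ (-1) (by norm_num) (rowFun f) (fun u => Pi.single u 1) h1
    (burau_braid hge (-1) Complex.I Complex.I_sq s hs hs2)
  have hval : ∀ u, ((φ (aof Γ ℓ u) : (Module.End ℂ (V → ℂ))ˣ) : Module.End ℂ (V → ℂ)) =
      1 - rk1 (rowFun f u) (Pi.single u 1) := fun u => reflRep_val ..
  refine ⟨φ, ?_, ?_⟩
  · apply Units.ext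
    rw [map_pow, map_mul, Units.val_pow_eq_pow_val, Units.val_mul, hval, hval, Units.val_one]
    exact (burau_pair (-1) Complex.I Complex.I_sq s hs hab hm).pow_two_m hm
  · rw [map_pow, map_pow]
    have hg := two_cos_ge_one _ hm
    refine unipotent_free _ _ _ _ _ _ (hval a) (hval b) ?_ ?_ ?_ ?_ _ (by omega)
    · rw [h1]; ring
    · rw [h1]; ring
    · rw [rowFun_single]
      simp only [f, burau_ne _ _ _ hab.ne, norm_mul, Complex.norm_I, one_mul]
      rw [Complex.norm_real]
      exact hg.trans (le_abs_self _)
    · rw [rowFun_single]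
      simp only [f, burau_ne _ _ _ hab.ne.symm, norm_mul, Complex.norm_I, one_mul]
      rw [Complex.norm_real]
      simp only [s, hsymm b a]
      exact hg.trans (le_abs_self _)

theorem exists_s {Γ : SimpleGraph V} {ℓ : V → V → ℕ} 
    (hge : ∀ u v, Γ.Adj u v → 2 ≤ ℓ u v) {a c : V} (n : ℕ) (hn : 2 ≤ n)
    (hn2 : n = 2 → ¬ Γ.Adj a c) : ∃ s1 s2 : ℝ,
      (Γ.Adj a c → s1 * s2 = (2 * Real.cos (Real.pi / ℓ a c)) ^ 2) ∧
      (Γ.Adj a c → ℓ a c = 2 → s1 = 0 ∧ s2 = 0) ∧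
      s1 ≠ 2 * Real.cos (Real.pi / n) ∧ s2 ≠ 2 * Real.cos (Real.pi / n) := by
  rcases hn.eq_or_lt with h2 | h3
  · subst h2
    refine ⟨1, 1, fun h => absurd h (hn2 rfl), fun h => absurd h (hn2 rfl), ?_, ?_⟩ <;>
    · rw [two_cos_two]; norm_num
  · have hg1 := two_cos_ge_one n h3
    have hg2 := two_cos_lt_two n hn
    by_cases hac : Γ.Adj a c
    · rcases (hge a c hac).eq_or_lt with h2 | h4
      · refine ⟨0, 0, fun _ => ?_, fun _ _ => ⟨rfl, rfl⟩, by linarith, by linarith⟩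
        rw [← h2, two_cos_two]; norm_num
      · have hl1 := two_cos_ge_one _ h4
        have hl2 := two_cos_lt_two _ (hge a c hac)
        refine ⟨4, (2 * Real.cos (Real.pi / ℓ a c)) ^ 2 / 4, fun _ => by ring, fun _ h => ?_, ?_, ?_⟩
        · omega
        · linarith
        · nlinarith
    · refine ⟨0, 0, fun h => absurd h hac, fun h => absurd h hac, by linarith, by linarith⟩

theorem rep_psi {Γ : SimpleGraph V} {ℓ : V → V → ℕ} (hsymm : ∀ u v, ℓ u v = ℓ v u)
    (hge : ∀ u v, Γ.Adj u v → 2 ≤ ℓ u v) {a b c : V} (hab : Γ.Adj a b) (hm : 3 ≤ ℓ a b)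
    (hbc : Γ.Adj b c) (hac : a ≠ c) (hnm : ℓ b c ≤ ℓ a b) (hn2 : ℓ b c = 2 → ¬ Γ.Adj a c) :
    ∃ (ψ : ArtinGroup Γ ℓ →* (Module.End ℂ (V → ℂ))ˣ) (K : ℕ) (y : ArtinGroup Γ ℓ),
      Commute y (aof Γ ℓ b) ∧
      ψ (aof Γ ℓ a ^ (4 * ℓ a b)) = 1 ∧ ψ (aof Γ ℓ b ^ (4 * ℓ a b)) = 1 ∧
      Function.Injective (FreeGroup.lift
        ![ψ (((aof Γ ℓ a * aof Γ ℓ b) ^ (2 * ℓ a b)) ^ K),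
          ψ (y * ((aof Γ ℓ a * aof Γ ℓ b) ^ (2 * ℓ a b)) ^ K * y⁻¹)]) := by
  obtain ⟨s1, s2, hs12, hs12', hs1, hs2⟩ := exists_s hge (a := a) (c := c) (ℓ b c) (hge b c hbc) hn2
  set m := ℓ a b with hmd
  set n := ℓ b c with hnd
  have hn : 2 ≤ n := hge b c hbc
  let s : V → V → ℝ := fun u v => if u = a ∧ v = c then s1 else if u = c ∧ v = a then s2 else
    2 * Real.cos (Real.pi / ℓ u v)
  have sac : s a c = s1 := by simp [s]
  have sca : s c a = s2 := by simp [s, hac]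
  have sgen : ∀ u v, ¬ (u = a ∧ v = c) → ¬ (u = c ∧ v = a) → s u v = 2 * Real.cos (Real.pi / ℓ u v) := by
    intro u v g1 g2
    simp only [s, if_neg g1, if_neg g2]
  have hs : ∀ u v, Γ.Adj u v → s u v * s v u = (2 * Real.cos (Real.pi / ℓ u v)) ^ 2 := by
    intro u v huv
    by_cases g1 : u = a ∧ v = c
    · obtain ⟨rfl, rfl⟩ := g1
      rw [sac, sca, hs12 huv]
    by_cases g2 : u = c ∧ v = a
    · obtain ⟨rfl, rfl⟩ := g2
      rw [sac, sca, hsymm, ← hs12 huv.symm, mul_comm]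
    rw [sgen u v g1 g2, sgen v u (by tauto) (by tauto), hsymm v u]; ring
  have hsz : ∀ u v, Γ.Adj u v → ℓ u v = 2 → s u v = 0 ∧ s v u = 0 := by
    intro u v huv h2
    by_cases g1 : u = a ∧ v = c
    · obtain ⟨rfl, rfl⟩ := g1
      rw [sac, sca]; exact hs12' huv h2
    by_cases g2 : u = c ∧ v = a
    · obtain ⟨rfl, rfl⟩ := g2
      rw [sac, sca]; exact (hs12' huv.symm (by rw [hsymm]; exact h2)).symm
    rw [sgen u v g1 g2, sgen v u (by tauto) (by tauto), hsymm v u, h2, two_cos_two]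
    simp
  have hm0 : (m : ℂ) ≠ 0 := by
    have : m ≠ 0 := by omega
    exact_mod_cast this
  let κ : ℂ := Complex.exp (Complex.I * (Real.pi / m))
  let q : ℂ := Complex.exp (Complex.I * (2 * Real.pi / m))
  have hκ0 : κ ≠ 0 := Complex.exp_ne_zero _
  have hq0 : q ≠ 0 := Complex.exp_ne_zero _
  have hκ : κ ^ 2 = q := by
    simp only [κ, q]
    rw [← Complex.exp_nat_mul]; push_cast; ring_nf
  have hprim : IsPrimitiveRoot q m := by
    have := Complex.isPrimitiveRoot_exp m (by omega)
    convert this using 2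
    ring
  have hqm : q ^ m = 1 := hprim.pow_eq_one
  have hg1 := two_cos_ge_one m hm
  have hqg : κ * ((2 * Real.cos (Real.pi / m) : ℝ) : ℂ) = 1 + q := by
    have : Complex.cos (Real.pi / m) = (κ + κ⁻¹) / 2 := by
      rw [Complex.cos, ← Complex.exp_neg]
      congr 3 <;> ring_nf
    push_cast
    rw [this, ← hκ]
    field_simp
    ring
  have hq1 : 1 + q ≠ 0 := by
    rw [← hqg]
    apply mul_ne_zero hκ0
    exact_mod_cast (by linarith : (2 * Real.cos (Real.pi / m)) ≠ 0)
  let f := burau q κ s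
  have h1 : ∀ u, rowFun f u (Pi.single u 1) = 1 + q := fun u => by
    rw [rowFun_single]; exact burau_self ..
  let ψ := reflRep Γ ℓ q hq0 (rowFun f) (fun u => Pi.single u 1) h1
    (burau_braid hge q κ hκ s hs hsz)
  have hval : ∀ u, ((ψ (aof Γ ℓ u) : (Module.End ℂ (V → ℂ))ˣ) : Module.End ℂ (V → ℂ)) =
      1 - rk1 (rowFun f u) (Pi.single u 1) := fun u => reflRep_val ..
  have hinv : ∀ u, (((ψ (aof Γ ℓ u))⁻¹ : (Module.End ℂ (V → ℂ))ˣ) : Module.End ℂ (V → ℂ)) =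
      1 - q⁻¹ • rk1 (rowFun f u) (Pi.single u 1) := fun u => reflRep_inv ..
  have htriv : ∀ u, ψ (aof Γ ℓ u ^ (4 * m)) = 1 := by
    intro u
    apply Units.ext
    rw [map_pow, Units.val_pow_eq_pow_val, hval, Units.val_one,
      one_sub_pow (q := q) (by rw [rk1_mul, h1]) hq1]
    have : (-q) ^ (4 * m) = 1 := by
      rw [Even.neg_pow ⟨2 * m, by ring⟩, mul_comm, pow_mul, hqm, one_pow]
    rw [this]; simp
  have hbc' : b ≠ c := hbc.ne
  have hab' : a ≠ b := hab.ne
  -- values of the form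
  have fab : f a b = 1 + q := by
    rw [← hqg]
    simp only [f]
    rw [burau_ne _ _ _ hab', sgen a b (by tauto) (by tauto)]
  have fba : f b a = 1 + q := by
    rw [← hqg]
    simp only [f]
    rw [burau_ne _ _ _ hab'.symm, sgen b a (by tauto) (by tauto), hsymm b a]
  have faa : f a a = 1 + q := burau_self ..
  have fbb : f b b = 1 + q := burau_self ..
  have fac : f a c = κ * s1 := by
    simp only [f]; rw [burau_ne _ _ _ hac, sac]
  have fca : f c a = κ * s2 := by
    simp only [f]; rw [burau_ne _ _ _ hac.symm, sca]
  have fbc : f b c = κ * ((2 * Real.cos (Real.pi / n) : ℝ) : ℂ) := by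
    simp only [f]; rw [burau_ne _ _ _ hbc', sgen b c (by tauto) (by tauto)]
  have fcb : f c b = κ * ((2 * Real.cos (Real.pi / n) : ℝ) : ℂ) := by
    simp only [f]; rw [burau_ne _ _ _ hbc'.symm, sgen c b (by tauto) (by tauto), hsymm c b]
  set g : ℝ := 2 * Real.cos (Real.pi / n) with hgd
  let h : (V → ℂ) →ₗ[ℂ] ℂ := rowFun f a - rowFun f b
  let r : V → ℂ := Pi.single a 1 - Pi.single b 1
  have hr : h r = 0 := by
    simp only [h, r, LinearMap.sub_apply, map_sub, rowFun_single, faa, fab, fba, fbb]; ring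
  have hec : h (Pi.single c 1) = κ * (s1 - g) := by
    simp only [h, LinearMap.sub_apply, rowFun_single, fac, fbc]; ring
  have heb : h (Pi.single b 1) = 0 := by
    simp only [h, LinearMap.sub_apply, rowFun_single, fab, fbb]; ring
  have hcr : rowFun f c r = κ * (s2 - g) := by
    simp only [r, map_sub, rowFun_single, fca, fcb]; ring
  have hbr : rowFun f b r = 0 := by
    simp only [r, map_sub, rowFun_single, fba, fbb]; ring
  have hne1 : ((s1 : ℂ) - g) ≠ 0 := by
    rw [sub_ne_zero]; exact_mod_cast hs1
  have hne2 : ((s2 : ℂ) - g) ≠ 0 := by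
    rw [sub_ne_zero]; exact_mod_cast hs2
  have hprod : (κ * (s2 - g)) * (κ * (s1 - g)) ≠ 0 :=
    mul_ne_zero (mul_ne_zero hκ0 hne2) (mul_ne_zero hκ0 hne1)
  -- the element B
  obtain ⟨β, hβ, hB⟩ : ∃ β : ℂ, β ≠ 0 ∧ ∀ x,
      ((ψ ((aof Γ ℓ a * aof Γ ℓ b) ^ (2 * m)) : (Module.End ℂ (V → ℂ))ˣ) : Module.End ℂ (V → ℂ)) x
        = x + (β * h x) • r := by
    have hpair := burau_pair q κ hκ s hs hab hm
    have hp := hpair.pow_m hm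
    have hX2 := hpair.X_sq
    have hsc := pow_end_scalar q m hm
    set x := xcoef q (2 * Real.pi / m) (m - 1) / Complex.sin (2 * Real.pi / m) with hx
    have hx0 : x ≠ 0 := div_ne_zero (xcoef_ne m hm) (sin_two_pi_div_ne m hm)
    rw [hqm] at hsc
    have hδ : 1 - 2 * q * Complex.cos (2 * Real.pi / m) + q ^ 2 = 0 := by
      have : x * (1 - 2 * q * Complex.cos (2 * Real.pi / m) + q ^ 2) = 0 := by
        linear_combination -hsc
      exact (mul_eq_zero.mp this).resolve_left hx0
    rw [← hmd, hδ, zero_smul] at hX2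
    refine ⟨- (2 * x * (1 + q)), neg_ne_zero.mpr (mul_ne_zero (mul_ne_zero two_ne_zero hx0) hq1), ?_⟩
    intro z
    rw [map_pow, map_mul, Units.val_pow_eq_pow_val, Units.val_mul, hval, hval, mul_comm 2 m, pow_mul,
      hp, hqm, pow_two]
    simp only [mul_add, add_mul, one_smul, one_mul, mul_one, smul_mul_assoc, mul_smul_comm, hX2,
      smul_zero, add_zero]
    simp only [reflX, hδ, rk1_mul, LinearMap.add_apply, LinearMap.smul_apply, LinearMap.sub_apply,
      Module.End.one_apply, rk1_apply, h, r]
    rw [rowFun_single, rowFun_single, show burau q κ s a b = 1 + q from fab,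
      show burau q κ s b a = 1 + q from fba]
    module
  -- the element y
  clear_value h r
  obtain ⟨y, hyb, hy1, hy2⟩ : ∃ y : ArtinGroup Γ ℓ, Commute y (aof Γ ℓ b) ∧
      h (((ψ y : (Module.End ℂ (V → ℂ))ˣ) : Module.End ℂ (V → ℂ)) r) ≠ 0 ∧
      h ((((ψ y)⁻¹ : (Module.End ℂ (V → ℂ))ˣ) : Module.End ℂ (V → ℂ)) r) ≠ 0 := by
    rcases hn.eq_or_lt with h2 | h3
    · refine ⟨aof Γ ℓ c, ?_, ?_, ?_⟩
      · have := aof_rel Γ ℓ hbc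
        rw [← hnd, ← h2, altProd_two, altProd_two] at this
        exact this.symm
      · rw [hval, LinearMap.sub_apply, map_sub, Module.End.one_apply, hr, rk1_apply, map_smul, hcr,
          hec, zero_sub, smul_eq_mul]
        exact neg_ne_zero.mpr hprod
      · rw [hinv, LinearMap.sub_apply, map_sub, Module.End.one_apply, hr, LinearMap.smul_apply,
          rk1_apply, map_smul, map_smul, hcr, hec, zero_sub, smul_eq_mul, smul_eq_mul]
        exact neg_ne_zero.mpr (mul_ne_zero (inv_ne_zero hq0) hprod)
    · have hpair := burau_pair q κ hκ s hs hbc h3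
      have hp := hpair.pow_m h3
      have hX2 := hpair.X_sq
      have hsc := pow_end_scalar q n h3
      have hx0 : xcoef q (2 * Real.pi / n) (n - 1) / Complex.sin (2 * Real.pi / n) ≠ 0 := by
        rcases hnm.eq_or_lt with he | hlt
        · rw [he]
          exact div_ne_zero (xcoef_ne m hm) (sin_two_pi_div_ne m hm)
        · intro h0
          rw [h0, zero_mul, add_zero] at hsc
          exact hprim.pow_ne_one_of_pos_of_lt (by omega) hlt hsc.symm
      rw [← hnd] at hX2
      set x := xcoef q (2 * Real.pi / n) (n - 1) / Complex.sin (2 * Real.pi / n) with hx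
      set t := 2 * q * Complex.cos (2 * Real.pi / n) with ht
      set X := reflX q t (rk1 (rowFun (burau q κ s) b) (Pi.single b 1))
        (rk1 (rowFun (burau q κ s) c) (Pi.single c 1)) with hX
      have hXr : h (X r) = - (1 + q) * ((κ * (s2 - g)) * (κ * (s1 - g))) := by
        rw [hX]
        simp only [reflX, rk1_mul, LinearMap.add_apply, LinearMap.smul_apply, LinearMap.sub_apply,
          Module.End.one_apply, rk1_apply, map_add, map_sub, map_smul, hr, hec, heb]
        rw [show rowFun (burau q κ s) b r = 0 from hbr, show rowFun (burau q κ s) c r = _ from hcr]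
        simp only [smul_eq_mul]
        ring
      have hXr0 : h (X r) ≠ 0 := by
        rw [hXr]; exact mul_ne_zero (neg_ne_zero.mpr hq1) hprod
      have hqn : q ^ n ≠ 0 := pow_ne_zero _ hq0
      have hyv : ((ψ ((aof Γ ℓ b * aof Γ ℓ c) ^ n) : (Module.End ℂ (V → ℂ))ˣ) :
          Module.End ℂ (V → ℂ)) = (q ^ n) • 1 + x • X := by
        rw [map_pow, map_mul, Units.val_pow_eq_pow_val, Units.val_mul, hval, hval]
        exact hp
      have hyi : (((ψ ((aof Γ ℓ b * aof Γ ℓ c) ^ n))⁻¹ : (Module.End ℂ (V → ℂ))ˣ) :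
          Module.End ℂ (V → ℂ)) = (q ^ n)⁻¹ • 1 - (x * (q ^ n)⁻¹) • X := by
        apply Units.inv_eq_of_mul_eq_one_right
        rw [hyv]
        simp only [mul_sub, add_mul, smul_mul_assoc, mul_smul_comm, one_mul, mul_one, hX2]
        generalize q ^ n = Q at hsc hqn
        match_scalars
        · field_simp
        · field_simp
          linear_combination x * hsc
      refine ⟨(aof Γ ℓ b * aof Γ ℓ c) ^ n, (central_of_braid (aof_rel Γ ℓ hbc)).1, ?_, ?_⟩
      · rw [hyv, LinearMap.add_apply, LinearMap.smul_apply, LinearMap.smul_apply, map_add, map_smul,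
          map_smul, Module.End.one_apply, hr, smul_zero, zero_add]
        exact mul_ne_zero hx0 hXr0
      · rw [hyi, LinearMap.sub_apply, LinearMap.smul_apply, LinearMap.smul_apply, map_sub, map_smul,
          map_smul, Module.End.one_apply, hr, smul_zero, zero_sub]
        exact neg_ne_zero.mpr (mul_ne_zero (mul_ne_zero hx0 (inv_ne_zero hqn)) hXr0)
  obtain ⟨K, hK⟩ := transvection_free h r _ _ β hβ hB hr hy1 hy2
  refine ⟨ψ, K, y, hyb, htriv a, htriv b, ?_⟩
  convert hK using 4
  · simp
  · simp

theorem not_lerf_triple {Γ : SimpleGraph V} {ℓ : V → V → ℕ} (hsymm : ∀ u v, ℓ u v = ℓ v u)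
    (hge : ∀ u v, Γ.Adj u v → 2 ≤ ℓ u v) {a b c : V} (hab : Γ.Adj a b) (hm : 3 ≤ ℓ a b)
    (hbc : Γ.Adj b c) (hac : a ≠ c) (hnm : ℓ b c ≤ ℓ a b) (hn2 : ℓ b c = 2 → ¬ Γ.Adj a c) :
    ¬ SubgroupSeparable (ArtinGroup Γ ℓ) := by
  obtain ⟨φ, hφ1, hφ⟩ := rep_phi hsymm hge hab hm
  obtain ⟨ψ, K, y, hyb, hψa, hψb, hψ⟩ := rep_psi hsymm hge hab hm hbc hac hnm hn2
  obtain ⟨ca, cb⟩ := central_of_braid (aof_rel Γ ℓ hab)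
  set A := aof Γ ℓ a
  set B := aof Γ ℓ b
  have hBa : Commute (((A * B) ^ (2 * ℓ a b)) ^ K) A := by
    rw [mul_comm 2, pow_mul]
    exact (ca.pow_left 2).pow_left K
  have hBb : Commute (((A * B) ^ (2 * ℓ a b)) ^ K) B := by
    rw [mul_comm 2, pow_mul]
    exact (cb.pow_left 2).pow_left K
  refine not_lerf_of_free (A := A ^ (4 * ℓ a b)) (B := ((A * B) ^ (2 * ℓ a b)) ^ K)
    (C := B ^ (4 * ℓ a b)) (D := y * ((A * B) ^ (2 * ℓ a b)) ^ K * y⁻¹)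
    (hBa.symm.pow_left _) (hBb.pow_right _) ?_ φ ψ ?_ ?_ hψa hψb hφ hψ
  · apply Commute.pow_left
    exact (hyb.symm.mul_right hBb.symm).mul_right hyb.symm.inv_right
  · rw [map_pow, hφ1, one_pow]
  · rw [map_mul, map_mul, map_pow, hφ1, one_pow, mul_one, ← map_mul, mul_inv_cancel, map_one]

end triple2


theorem not_lerf_badTriple {V : Type*} [Fintype V] {Γ : SimpleGraph V} {ℓ : V → V → ℕ}
    (hsymm : ∀ u v, ℓ u v = ℓ v u)
    (hge : ∀ u v, Γ.Adj u v → 2 ≤ ℓ u v) {a b c : V} (h : BadTriple Γ ℓ a b c) :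
    ¬ SubgroupSeparable (ArtinGroup Γ ℓ) := by
  classical
  obtain ⟨hac, hab, hbc, h3, hno⟩ := h
  have key : ∀ {a b c : V}, Γ.Adj a b → Γ.Adj b c → a ≠ c → 3 ≤ ℓ a b → 
      (ℓ b c = 2 → ¬ Γ.Adj a c) → ¬ SubgroupSeparable (ArtinGroup Γ ℓ) := by
    intro a b c hab hbc hac h3 h2
    rcases le_or_gt (ℓ b c) (ℓ a b) with hle | hlt
    · exact not_lerf_triple hsymm hge hab h3 hbc hac hle h2
    · have e1 := hsymm a b
      have e2 := hsymm b c
      exact not_lerf_triple hsymm hge hbc.symm (by omega) hab.symm hac.symm (by omega)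
        (by intro h; omega)
  by_cases hadj : Γ.Adj a c
  · by_cases hbc2 : ℓ b c = 2
    · have h4 : 3 ≤ ℓ a c := by
        have := hge a c hadj
        have : ℓ a c ≠ 2 := fun h => hno ⟨hadj, hbc2, h⟩
        omega
      exact key hab.symm hadj hbc.ne (by rw [hsymm]; exact h3) (by omega)
    · exact key hab hbc hac h3 (fun h => absurd h hbc2)
  · exact key hab hbc hac h3 (fun _ => hadj)

theorem altProd_one_even {G : Type*} [Monoid G] (x : G) {n : ℕ} (hn : Even n) :
    altProd x 1 n = altProd 1 x n := by
  obtain ⟨k, rfl⟩ := hn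
  rw [← two_mul, altProd_even, altProd_even, mul_one, one_mul]

theorem class_rep {V : Type*} {Γ : SimpleGraph V} {ℓ : V → V → ℕ} (hsymm : ∀ u v, ℓ u v = ℓ v u)
    (PA PC : V → Prop) (hdis : ∀ u, PA u → ¬ PC u) (z : ℂ) (hz : 1 ≤ ‖z‖)
    (hAC : ∀ u v, Γ.Adj u v → PA u → PC v → 3 ≤ ℓ u v ∧
      z * z = -1 * (2 * Real.cos (Real.pi / ℓ u v)) ^ 2)
    (hout : ∀ u v, Γ.Adj u v → (PA u ∨ PC u) → ¬ PA v → ¬ PC v → Even (ℓ u v))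
    {a c : V} (ha : PA a) (hc : PC c) :
    ∃ φ : ArtinGroup Γ ℓ →* (Module.End ℂ (ℂ × ℂ))ˣ,
      (∀ u, ¬ PA u → ¬ PC u → φ (aof Γ ℓ u) = 1) ∧
      Function.Injective (FreeGroup.lift ![φ (aof Γ ℓ a ^ 2), φ (aof Γ ℓ c ^ 2)]) := by
  classical
  let hA : (ℂ × ℂ) →ₗ[ℂ] ℂ := z • LinearMap.snd ℂ ℂ ℂ
  let hC : (ℂ × ℂ) →ₗ[ℂ] ℂ := z • LinearMap.fst ℂ ℂ ℂ
  let eA : ℂ × ℂ := (1, 0)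
  let eC : ℂ × ℂ := (0, 1)
  have aa : hA eA = 0 := by simp [hA, eA]
  have ac : hA eC = z := by simp [hA, eC]
  have ca : hC eA = z := by simp [hC, eA]
  have cc : hC eC = 0 := by simp [hC, eC]
  clear_value hA hC eA eC
  let h : V → (ℂ × ℂ) →ₗ[ℂ] ℂ := fun u => if PA u then hA else if PC u then hC else 0
  let e : V → ℂ × ℂ := fun u => if PA u then eA else if PC u then eC else 0
  have hA' : ∀ u, PA u → h u = hA ∧ e u = eA := fun u hu => by simp [h, e, hu]
  have hC' : ∀ u, PC u → h u = hC ∧ e u = eC := fun u hu => by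
    have : ¬ PA u := fun h' => hdis u h' hu
    simp [h, e, hu, this]
  have hO' : ∀ u, ¬ PA u → ¬ PC u → h u = 0 ∧ e u = 0 := fun u h1 h2 => by simp [h, e, h1, h2]
  clear_value h e
  have h1 : ∀ u, h u (e u) = 1 + (-1) := by
    intro u
    by_cases g1 : PA u
    · rw [(hA' u g1).1, (hA' u g1).2, aa]; ring
    by_cases g2 : PC u
    · rw [(hC' u g2).1, (hC' u g2).2, cc]; ring
    rw [(hO' u g1 g2).1]; simp
  have hz0 : (1 : Module.End ℂ (ℂ × ℂ)) - rk1 0 0 = 1 := by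
    rw [sub_eq_self]; ext <;> simp [rk1]
  have hEout : ∀ u, ¬ PA u → ¬ PC u → (1 - rk1 (h u) (e u) : Module.End ℂ (ℂ × ℂ)) = 1 := by
    intro u g1 g2
    rw [(hO' u g1 g2).1, (hO' u g1 g2).2, hz0]
  have hACbr : ∀ u v, Γ.Adj u v → PA u → PC v →
      altProd (1 - rk1 (h u) (e u)) (1 - rk1 (h v) (e v)) (ℓ u v) =
        altProd (1 - rk1 (h v) (e v)) (1 - rk1 (h u) (e u)) (ℓ u v) := by
    intro u v huv hu hv
    obtain ⟨g3, gz⟩ := hAC u v huv hu hv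
    refine (rk1_braid (q := -1) (h1 u) (h1 v) g3 ?_).braid g3
    rw [(hA' u hu).1, (hA' u hu).2, (hC' v hv).1, (hC' v hv).2, ac, ca, gz]
  have hbr : ∀ u v, Γ.Adj u v → altProd (1 - rk1 (h u) (e u)) (1 - rk1 (h v) (e v)) (ℓ u v) =
      altProd (1 - rk1 (h v) (e v)) (1 - rk1 (h u) (e u)) (ℓ u v) := by
    intro u v huv
    by_cases gu : PA u ∨ PC u
    · by_cases gv : PA v ∨ PC v
      · rcases gu with gu | gu <;> rcases gv with gv | gv
        · rw [(hA' u gu).1, (hA' u gu).2, (hA' v gv).1, (hA' v gv).2]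
        · exact hACbr u v huv gu gv
        · have := hACbr v u huv.symm gv gu
          rw [hsymm] at this
          exact this.symm
        · rw [(hC' u gu).1, (hC' u gu).2, (hC' v gv).1, (hC' v gv).2]
      · push Not at gv
        rw [hEout v gv.1 gv.2]
        exact altProd_one_even _ (hout u v huv gu gv.1 gv.2)
    · push Not at gu
      by_cases gv : PA v ∨ PC v
      · rw [hEout u gu.1 gu.2]
        have := hout v u huv.symm gv gu.1 gu.2
        rw [hsymm] at this
        exact (altProd_one_even _ this).symm
      · push Not at gv
        rw [hEout u gu.1 gu.2, hEout v gv.1 gv.2]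
  let φ := reflRep Γ ℓ (-1) (by norm_num) h e h1 hbr
  have hval : ∀ u, ((φ (aof Γ ℓ u) : (Module.End ℂ (ℂ × ℂ))ˣ) : Module.End ℂ (ℂ × ℂ)) =
      1 - rk1 (h u) (e u) := fun u => reflRep_val ..
  refine ⟨φ, ?_, ?_⟩
  · intro u g1 g2
    apply Units.ext
    rw [hval, hEout u g1 g2, Units.val_one]
  · rw [map_pow, map_pow]
    refine unipotent_free _ _ _ _ _ _ (hval a) (hval c) ?_ ?_ ?_ ?_ _ le_rfl
    · rw [h1]; ring
    · rw [h1]; ring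
    · rw [(hA' a ha).1, (hC' c hc).2, ac]; exact hz
    · rw [(hA' a ha).2, (hC' c hc).1, ca]; exact hz

theorem sq_rep {V : Type*} {Γ : SimpleGraph V} {ℓ : V → V → ℕ} (hsymm : ∀ u v, ℓ u v = ℓ v u)
    (hge : ∀ u v, Γ.Adj u v → 2 ≤ ℓ u v) (hnt : ∀ a b c, ¬ BadTriple Γ ℓ a b c)
    {a c : V} (hac : a ≠ c) (h3 : Γ.Adj a c → 3 ≤ ℓ a c) :
    ∃ φ : ArtinGroup Γ ℓ →* (Module.End ℂ (ℂ × ℂ))ˣ,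
      (∀ u, u ≠ a → u ≠ c → (Γ.Adj a u → ℓ a u = 2) → (Γ.Adj c u → ℓ c u = 2) →
        φ (aof Γ ℓ u) = 1) ∧
      Function.Injective (FreeGroup.lift ![φ (aof Γ ℓ a ^ 2), φ (aof Γ ℓ c ^ 2)]) := by
  by_cases hadj : Γ.Adj a c
  · have hm := h3 hadj
    have heven : ∀ x y v, Γ.Adj x v → Γ.Adj x y → 3 ≤ ℓ x y → v ≠ y → Even (ℓ x v) := by
      intro x y v hxv hxy hl hvy
      have h2 : ℓ x v = 2 := by
        by_contra hne
        have := hge x v hxv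
        refine hnt v x y ⟨hvy, hxv.symm, hxy, by rw [hsymm]; omega, ?_⟩
        rintro ⟨-, h, -⟩
        omega
      rw [h2]; exact even_two
    obtain ⟨φ, h1, h2⟩ := class_rep (Γ := Γ) hsymm (fun u => u = a) (fun u => u = c)
      (by rintro u rfl h; exact hac h)
      (Complex.I * ((2 * Real.cos (Real.pi / ℓ a c) : ℝ) : ℂ)) (by
        rw [norm_mul, Complex.norm_I, one_mul, Complex.norm_real]
        exact (two_cos_ge_one _ hm).trans (le_abs_self _))
      (by
        rintro u v huv rfl rfl
        refine ⟨hm, ?_⟩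
        push_cast
        linear_combination (2 * Complex.cos (Real.pi / ℓ u v)) ^ 2 * Complex.I_sq)
      (by
        rintro u v huv (rfl | rfl) g1 g2
        · exact heven _ _ _ huv hadj hm g2
        · exact heven _ _ _ huv hadj.symm (by rw [hsymm]; exact hm) g1)
      rfl rfl
    exact ⟨φ, fun u g1 g2 _ _ => h1 u g1 g2, h2⟩
  · -- twin classes
    have odd3 : ∀ {x y}, Γ.Adj x y → Odd (ℓ x y) → 3 ≤ ℓ x y := by
      intro x y hxy ho
      have := hge x y hxy
      obtain ⟨k, hk⟩ := ho
      omega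
    -- a twin of `x` is not adjacent to a vertex not adjacent to `x`
    have tw : ∀ {x x' y}, Γ.Adj x x' → Odd (ℓ x x') → Γ.Adj x' y → x ≠ y →
        Γ.Adj x y ∧ ℓ x' y = 2 ∧ ℓ x y = 2 := by
      intro x x' y h1 ho h2 hne
      by_contra hcon
      exact hnt x x' y ⟨hne, h1, h2, odd3 h1 ho, hcon⟩
    have hca : ¬ Γ.Adj c a := fun h => hadj h.symm
    have hnoedge : ∀ u v, Γ.Adj u v → (u = a ∨ Γ.Adj a u ∧ Odd (ℓ a u)) →
        (v = c ∨ Γ.Adj c v ∧ Odd (ℓ c v)) → False := by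
      rintro u v huv (rfl | ⟨g1, g2⟩) (rfl | ⟨g3, g4⟩)
      · exact hadj huv
      · exact hca (tw g3 g4 huv.symm hac.symm).1
      · exact hadj (tw g1 g2 huv hac).1
      · by_cases hav : a = v
        · subst hav; exact hca g3
        · exact hca (tw g3 g4 (tw g1 g2 huv hav).1.symm hac.symm).1
    have heven : ∀ x u v, Γ.Adj u v → (u = x ∨ Γ.Adj x u ∧ Odd (ℓ x u)) →
        ¬ (v = x ∨ Γ.Adj x v ∧ Odd (ℓ x v)) → Even (ℓ u v) := by
      rintro x u v huv (rfl | ⟨g1, g2⟩) g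
      · by_contra hne
        exact g (Or.inr ⟨huv, Nat.not_even_iff_odd.mp hne⟩)
      · have hxv : x ≠ v := fun h => g (Or.inl h.symm)
        rw [(tw g1 g2 huv hxv).2.1]; exact even_two
    obtain ⟨φ, h1, h2⟩ := class_rep (Γ := Γ) hsymm (fun u => u = a ∨ Γ.Adj a u ∧ Odd (ℓ a u))
      (fun u => u = c ∨ Γ.Adj c u ∧ Odd (ℓ c u))
      (by
        rintro u (rfl | ⟨g1, g2⟩) (g | ⟨g3, g4⟩)
        · exact hac g
        · exact hca g3
        · subst g; exact hadj g1
        · exact hadj (tw g1 g2 g3.symm hac).1)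
      1 (by simp)
      (fun u v huv gu gv => (hnoedge u v huv gu gv).elim)
      (by
        rintro u v huv (gu | gu) g1 g2
        · exact heven a u v huv gu g1
        · exact heven c u v huv gu g2)
      (a := a) (c := c) (Or.inl rfl) (Or.inl rfl)
    refine ⟨φ, fun u g1 g2 g3 g4 => h1 u ?_ ?_, h2⟩
    · rintro (h | ⟨h, ho⟩)
      · exact g1 h
      · rw [g3 h] at ho; exact absurd ho (by decide)
    · rintro (h | ⟨h, ho⟩)
      · exact g2 h
      · rw [g4 h] at ho; exact absurd ho (by decide)

theorem not_lerf_badSquare {V : Type*} {Γ : SimpleGraph V} {ℓ : V → V → ℕ}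
    (hsymm : ∀ u v, ℓ u v = ℓ v u)
    (hge : ∀ u v, Γ.Adj u v → 2 ≤ ℓ u v) (hnt : ∀ a b c, ¬ BadTriple Γ ℓ a b c) {a b c d : V}
    (h : BadSquare Γ ℓ a b c d) : ¬ SubgroupSeparable (ArtinGroup Γ ℓ) := by
  obtain ⟨hac, hbd, had, ab, bc, cd, lab, lbc, lcd, h1, h2, h3⟩ := h
  obtain ⟨φ, p1, p2⟩ := sq_rep hsymm hge hnt hac h1
  obtain ⟨ψ, r1, r2⟩ := sq_rep hsymm hge hnt hbd h2
  have comm : ∀ {u v}, Γ.Adj u v → ℓ u v = 2 → Commute (aof Γ ℓ u ^ 2) (aof Γ ℓ v ^ 2) := by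
    intro u v huv h2
    have := aof_rel Γ ℓ huv
    rw [h2, altProd_two, altProd_two] at this
    exact Commute.pow_pow this 2 2
  refine not_lerf_of_free (comm ab lab) (comm bc lbc) (comm cd lcd) φ ψ ?_ ?_ ?_ ?_ p2 r2
  · rw [map_pow, p1 b ab.ne.symm bc.ne (fun _ => lab) (fun _ => by rw [hsymm]; exact lbc), one_pow]
  · rw [map_pow, p1 d had.symm cd.ne.symm h3 (fun _ => lcd), one_pow]
  · rw [map_pow, r1 a ab.ne had (fun _ => by rw [hsymm]; exact lab)
      (fun h => by rw [hsymm]; exact h3 h.symm), one_pow]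
  · rw [map_pow, r1 c bc.ne.symm cd.ne (fun _ => lbc) (fun _ => by rw [hsymm]; exact lcd), one_pow]


theorem injective_four {V : Type*} {a b c d : V} (h1 : a ≠ b) (h2 : a ≠ c) (h3 : a ≠ d) (h4 : b ≠ c)
    (h5 : b ≠ d) (h6 : c ≠ d) : Function.Injective ![a, b, c, d] := by
  intro i j hij
  fin_cases i <;> fin_cases j <;> simp_all

theorem injective_three {V : Type*} {a b c : V} (h1 : a ≠ b) (h2 : a ≠ c) (h4 : b ≠ c) :
    Function.Injective ![a, b, c] := by
  intro i j hij
  fin_cases i <;> fin_cases j <;> simp_all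

theorem bad_of_forbidden {V : Type*} {Γ : SimpleGraph V} {ℓ : V → V → ℕ}
    (hsymm : ∀ u v, ℓ u v = ℓ v u)
    (h : HasForbiddenNonTriangle Γ ℓ ∨ HasForbiddenTriangle Γ ℓ) :
    (∃ a b c, BadTriple Γ ℓ a b c) ∨ ∃ a b c d, BadSquare Γ ℓ a b c d := by
  rcases h with (⟨φ, hi, hA, hl⟩ | ⟨φ, hi, hA, hl⟩ | ⟨p, hp, φ, hi, hA, hl⟩ |
    ⟨p, q, hp, hq, φ, hi, hA, hl⟩ | ⟨m, n, hm, hn, hmn, φ, hi, hA, hl⟩) |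
    ⟨l, m, n, hl2, hm2, hn2, hsum, φ, hi, hA, hl⟩
  · right
    refine ⟨φ 0, φ 1, φ 2, φ 3, hi.ne (by decide), hi.ne (by decide), hi.ne (by decide),
      (hA _ _).2 ?_, (hA _ _).2 ?_, (hA _ _).2 ?_, hl _ _ ?_, hl _ _ ?_, hl _ _ ?_,
      fun h => absurd ((hA _ _).1 h) ?_, fun h => absurd ((hA _ _).1 h) ?_,
      fun h => absurd ((hA _ _).1 h) ?_⟩ <;> simp [SimpleGraph.pathGraph_adj]
  · right
    refine ⟨φ 0, φ 1, φ 2, φ 3, hi.ne (by decide), hi.ne (by decide), hi.ne (by decide),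
      (hA _ _).2 ?_, (hA _ _).2 ?_, (hA _ _).2 ?_, hl _ _ ?_, hl _ _ ?_, hl _ _ ?_,
      fun h => absurd ((hA _ _).1 h) ?_, fun h => absurd ((hA _ _).1 h) ?_,
      fun h => hl _ _ ?_⟩ <;> simp [SimpleGraph.cycleGraph_adj] <;> decide
  · right
    refine ⟨φ 0, φ 1, φ 2, φ 3, hi.ne (by decide), hi.ne (by decide), hi.ne (by decide),
      (hA _ _).2 ?_, (hA _ _).2 ?_, (hA _ _).2 ?_, (hl _ _ ?_).trans ?_, (hl _ _ ?_).trans ?_,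
      (hl _ _ ?_).trans ?_,
      fun h => absurd ((hA _ _).1 h) ?_, fun h => (hl _ _ ((hA _ _).1 h)).symm ▸ ?_,
      fun h => (hl _ _ ?_).trans ?_⟩ <;> simp [SpGraph, SpLabel]
    omega
  · right
    refine ⟨φ 0, φ 1, φ 2, φ 3, hi.ne (by decide), hi.ne (by decide), hi.ne (by decide),
      (hA _ _).2 ?_, (hA _ _).2 ?_, (hA _ _).2 ?_, (hl _ _ ?_).trans ?_, (hl _ _ ?_).trans ?_,
      (hl _ _ ?_).trans ?_,
      fun h => (hl _ _ ((hA _ _).1 h)).symm ▸ ?_, fun h => (hl _ _ ((hA _ _).1 h)).symm ▸ ?_,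
      fun h => (hl _ _ ?_).trans ?_⟩ <;> simp [SpqLabel] <;> omega
  · left
    have a01 : Γ.Adj (φ 0) (φ 1) := (hA _ _).2 (by simp [SimpleGraph.pathGraph_adj])
    have a12 : Γ.Adj (φ 1) (φ 2) := (hA _ _).2 (by simp [SimpleGraph.pathGraph_adj])
    have a02 : ¬ Γ.Adj (φ 0) (φ 2) := fun h => absurd ((hA _ _).1 h) (by simp [SimpleGraph.pathGraph_adj])
    have l01 : ℓ (φ 0) (φ 1) = m := (hl _ _ ((hA _ _).1 a01)).trans (by simp [P3Label])
    have l12 : ℓ (φ 1) (φ 2) = n := (hl _ _ ((hA _ _).1 a12)).trans (by simp [P3Label])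
    have hne : φ 0 ≠ φ 2 := hi.ne (by decide)
    by_cases h3 : 3 ≤ m
    · exact ⟨φ 0, φ 1, φ 2, hne, a01, a12, by omega, fun h => a02 h.1⟩
    · exact ⟨φ 2, φ 1, φ 0, hne.symm, a12.symm, a01.symm, by rw [hsymm]; omega, fun h => a02 h.1.symm⟩
  · left
    have a01 : Γ.Adj (φ 0) (φ 1) := (hA _ _).2 (by simp)
    have a12 : Γ.Adj (φ 1) (φ 2) := (hA _ _).2 (by simp)
    have a02 : Γ.Adj (φ 0) (φ 2) := (hA _ _).2 (by simp)
    have l01 : ℓ (φ 0) (φ 1) = l := (hl _ _ ((hA _ _).1 a01)).trans (by simp [triLabel])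
    have l12 : ℓ (φ 1) (φ 2) = m := (hl _ _ ((hA _ _).1 a12)).trans (by simp [triLabel])
    have l02 : ℓ (φ 0) (φ 2) = n := (hl _ _ ((hA _ _).1 a02)).trans (by simp [triLabel])
    have l20 := hsymm (φ 2) (φ 0)
    by_cases h3 : 3 ≤ l
    · refine ⟨φ 0, φ 1, φ 2, a02.ne, a01, a12, by omega, ?_⟩
      rintro ⟨-, h1, h2⟩
      rw [if_pos (by omega : m = 2), if_pos (by omega : n = 2)] at hsum
      omega
    · have hl2' : l = 2 := by omega
      rw [if_pos hl2'] at hsum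
      have hm3 : m ≠ 2 := by intro h; rw [if_pos h] at hsum; omega
      have hn3 : n ≠ 2 := by intro h; rw [if_pos h] at hsum; omega
      refine ⟨φ 1, φ 2, φ 0, a01.ne.symm, a12, a02.symm, by omega, ?_⟩
      rintro ⟨-, h1, h2⟩
      omega

theorem forbidden_of_badTriple {V : Type*} {Γ : SimpleGraph V} {ℓ : V → V → ℕ}
    (hsymm : ∀ u v, ℓ u v = ℓ v u) (hge : ∀ u v, Γ.Adj u v → 2 ≤ ℓ u v) {a b c : V}
    (h : BadTriple Γ ℓ a b c) : HasForbiddenNonTriangle Γ ℓ ∨ HasForbiddenTriangle Γ ℓ := by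
  obtain ⟨hac, hab, hbc, h3, hno⟩ := h
  have hinj := injective_three hab.ne hac hbc.ne
  have s1 := hsymm b a
  have s2 := hsymm c b
  have s3 := hsymm c a
  have b2 := hge b c hbc
  by_cases hadj : Γ.Adj a c
  · right
    have c2 := hge a c hadj
    refine ⟨ℓ a b, ℓ b c, ℓ a c, by omega, b2, c2, ?_, ![a, b, c], hinj, ?_, ?_⟩
    · rw [if_neg (by omega)]
      by_cases h1 : ℓ b c = 2
      · rw [if_neg (fun h => hno ⟨hadj, h1, h⟩)]; split_ifs <;> omega
      · rw [if_neg h1]; split_ifs <;> omega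
    · intro i j
      fin_cases i <;> fin_cases j <;> simp [hab, hab.symm, hbc, hbc.symm, hadj, hadj.symm]
    · intro i j
      fin_cases i <;> fin_cases j <;> simp [triLabel, s1, s2, s3]
  · left; right; right; right; right
    have hca : ¬ Γ.Adj c a := fun h => hadj h.symm
    refine ⟨ℓ a b, ℓ b c, by omega, b2, by omega, ![a, b, c], hinj, ?_, ?_⟩
    · intro i j
      fin_cases i <;> fin_cases j <;>
        simp [hab, hab.symm, hbc, hbc.symm, hadj, hca, SimpleGraph.pathGraph_adj]
    · intro i j
      fin_cases i <;> fin_cases j <;> simp [P3Label, s1, s2, SimpleGraph.pathGraph_adj]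

theorem forbidden_of_badSquare {V : Type*} {Γ : SimpleGraph V} {ℓ : V → V → ℕ}
    (hsymm : ∀ u v, ℓ u v = ℓ v u) (hge : ∀ u v, Γ.Adj u v → 2 ≤ ℓ u v) {a b c d : V}
    (h : BadSquare Γ ℓ a b c d) : HasForbiddenNonTriangle Γ ℓ ∨ HasForbiddenTriangle Γ ℓ := by
  obtain ⟨hac, hbd, had, ab, bc, cd, lab, lbc, lcd, h1, h2, h3⟩ := h
  have hinj := injective_four ab.ne hac had bc.ne hbd cd.ne
  have lba : ℓ b a = 2 := by rw [hsymm]; exact lab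
  have lcb : ℓ c b = 2 := by rw [hsymm]; exact lbc
  have ldc : ℓ d c = 2 := by rw [hsymm]; exact lcd
  by_cases ad : Γ.Adj a d
  · left
    have lad := h3 ad
    have lda : ℓ d a = 2 := by rw [hsymm]; exact lad
    by_cases ac : Γ.Adj a c
    · have lca := hsymm c a
      have p3 := h1 ac
      by_cases bd : Γ.Adj b d
      · have ldb := hsymm d b
        have q3 := h2 bd
        right; right; right; left
        refine ⟨ℓ b d, ℓ a c, by omega, by omega, ![a, b, c, d], hinj, ?_, ?_⟩
        · intro i j
          fin_cases i <;> fin_cases j <;>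
            simp [ab, ab.symm, bc, bc.symm, cd, cd.symm, ad, ad.symm, ac, ac.symm, bd, bd.symm]
        · intro i j
          fin_cases i <;> fin_cases j <;>
            simp [SpqLabel, lab, lba, lbc, lcb, lcd, ldc, lad, lda, lca, ldb]
      · have db : ¬ Γ.Adj d b := fun h => bd h.symm
        right; right; left
        have hinj2 := injective_four bc.ne hbd ab.ne.symm cd.ne hac.symm had.symm
        refine ⟨ℓ a c, by omega, ![b, c, d, a], hinj2, ?_, ?_⟩
        · intro i j
          fin_cases i <;> fin_cases j <;>
            simp [SpGraph, ab, ab.symm, bc, bc.symm, cd, cd.symm, ad, ad.symm, ac, ac.symm, bd, db]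
        · intro i j
          fin_cases i <;> fin_cases j <;>
            simp [SpGraph, SpLabel, lab, lba, lbc, lcb, lcd, ldc, lad, lda, lca]
    · have ca : ¬ Γ.Adj c a := fun h => ac h.symm
      by_cases bd : Γ.Adj b d
      · have ldb := hsymm d b
        have q3 := h2 bd
        right; right; left
        refine ⟨ℓ b d, by omega, ![a, b, c, d], hinj, ?_, ?_⟩
        · intro i j
          fin_cases i <;> fin_cases j <;>
            simp [SpGraph, ab, ab.symm, bc, bc.symm, cd, cd.symm, ad, ad.symm, ac, ca, bd, bd.symm]
        · intro i j
          fin_cases i <;> fin_cases j <;>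
            simp [SpGraph, SpLabel, lab, lba, lbc, lcb, lcd, ldc, lad, lda, ldb]
      · have db : ¬ Γ.Adj d b := fun h => bd h.symm
        right; left
        refine ⟨![a, b, c, d], hinj, ?_, ?_⟩
        · intro i j
          fin_cases i <;> fin_cases j <;>
            simp [SimpleGraph.cycleGraph_adj, ab, ab.symm, bc, bc.symm, cd, cd.symm, ad, ad.symm,
              ac, ca, bd, db] <;> decide
        · intro i j hij
          fin_cases i <;> fin_cases j <;>
            first
            | (simp [lab, lba, lbc, lcb, lcd, ldc, lad, lda]; done)
            | (exfalso; revert hij; simp [SimpleGraph.cycleGraph_adj]; done)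
            | (exfalso; revert hij; simp [SimpleGraph.cycleGraph_adj]; decide)
  · by_cases bd : Γ.Adj b d
    · exact forbidden_of_badTriple hsymm hge (a := d) (b := b) (c := a)
        ⟨had.symm, bd.symm, ab.symm, by rw [hsymm]; exact h2 bd, fun h => ad h.1.symm⟩
    by_cases ac : Γ.Adj a c
    · exact forbidden_of_badTriple hsymm hge (a := a) (b := c) (c := d)
        ⟨had, ac, cd, h1 ac, fun h => ad h.1⟩
    left; left
    have ca : ¬ Γ.Adj c a := fun h => ac h.symm
    have db : ¬ Γ.Adj d b := fun h => bd h.symm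
    have da : ¬ Γ.Adj d a := fun h => ad h.symm
    refine ⟨![a, b, c, d], hinj, ?_, ?_⟩
    · intro i j
      fin_cases i <;> fin_cases j <;>
        simp [SimpleGraph.pathGraph_adj, ab, ab.symm, bc, bc.symm, cd, cd.symm, ad, da,
          ac, ca, bd, db]
    · intro i j
      fin_cases i <;> fin_cases j <;>
        simp [SimpleGraph.pathGraph_adj, lab, lba, lbc, lcb, lcd, ldc]

theorem main_artin {V : Type*} [Fintype V] (Γ : SimpleGraph V) (ℓ : V → V → ℕ)
    (hsymm : ∀ u v, ℓ u v = ℓ v u) (hge : ∀ u v, Γ.Adj u v → 2 ≤ ℓ u v) :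
    SubgroupSeparable (ArtinGroup Γ ℓ) ↔
      ¬ (HasForbiddenNonTriangle Γ ℓ ∨ HasForbiddenTriangle Γ ℓ) := by
  constructor
  · intro hsep hforb
    by_cases hT : ∃ a b c, BadTriple Γ ℓ a b c
    · obtain ⟨a, b, c, h⟩ := hT
      exact not_lerf_badTriple hsymm hge h hsep
    · have hT' : ∀ a b c, ¬ BadTriple Γ ℓ a b c := fun a b c h => hT ⟨a, b, c, h⟩
      obtain ⟨a, b, c, d, h⟩ := (bad_of_forbidden hsymm hforb).resolve_left hT
      exact not_lerf_badSquare hsymm hge hT' h hsep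
  · intro hno
    refine lerf_of_no_bad (Fintype.card V) le_rfl Γ ℓ hsymm hge ?_ ?_
    · intro a b c h
      exact hno (forbidden_of_badTriple hsymm hge h)
    · intro a b c d h
      exact hno (forbidden_of_badSquare hsymm hge h)

/-- Almeida–Lima. An Artin group `A(Γ)` is subgroup separable if and only
if `Γ` does not contain, as an induced labeled subgraph, any of: `P₄` or `C₄` with all edges
labeled `2`, `S_p` with `p > 2`, `S_{p,q}` with `p, q > 2`, `P₃^{m,n}` with `m + n > 4`, or a
triangle `Δ_{l,m,n}` with at most one edge labeled `2`. -/
theorem stmt_16 {V : Type*} [Fintype V] (Γ : SimpleGraph V) (ℓ : V → V → ℕ)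
    (hsymm : ∀ u v, ℓ u v = ℓ v u) (hge : ∀ u v, Γ.Adj u v → 2 ≤ ℓ u v) :
    SubgroupSeparable (ArtinGroup Γ ℓ) ↔
      ¬ (HasForbiddenNonTriangle Γ ℓ ∨ HasForbiddenTriangle Γ ℓ) := by
  exact main_artin Γ ℓ hsymm hge
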